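/- arXiv:1803.00789 — 4 statements merged into one kernel-verified Lean document; each statement's English description precedes it below -/
import Mathlib

section
/- Let α ∈ [0,∞)^d and f ∈ C_c^∞(ℝ_+^d). Then for every x ∈ ℝ_+^d, lim_{t→0^+} t ∂_t P_t^α f(x) = 0. -/
open MeasureTheory Real Filter Set
open scoped ENNReal BigOperators

noncomputable section

/-- The open positive orthant `(0,∞)^d`. -/
def posOrth (d : ℕ) : Set (Fin d → ℝ) := {x | ∀ j, 0 < x j}

/-- The weighted measure `x^{2α} dx` on the positive orthant. -/
def wMeasure (d : ℕ) (α : Fin d → ℝ) : Measure (Fin d → ℝ) :=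
  (volume.restrict (posOrth d)).withDensity
    (fun x => ENNReal.ofReal (∏ j, (x j) ^ (2 * α j)))

/-- The Bessel function of the first kind of order `μ`. -/
def besselJ (μ : ℝ) (z : ℝ) : ℝ :=
  ∑' k : ℕ, ((-1 : ℝ) ^ k / ((k.factorial : ℝ) * Real.Gamma ((k : ℝ) + μ + 1))) *
    (z / 2) ^ (2 * (k : ℝ) + μ)

/-- The modified Bessel function of the first kind of order `μ`. -/
def besselI (μ : ℝ) (z : ℝ) : ℝ :=
  ∑' k : ℕ, (1 / ((k.factorial : ℝ) * Real.Gamma ((k : ℝ) + μ + 1))) *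
    (z / 2) ^ (2 * (k : ℝ) + μ)

/-- The eigenfunctions `φ_y^α(x) = ∏_j (x_j y_j)^{-α_j+1/2} J_{α_j-1/2}(x_j y_j)`. -/
def phiFn (d : ℕ) (α : Fin d → ℝ) (y x : Fin d → ℝ) : ℝ :=
  ∏ j, ((x j * y j) ^ (-(α j) + 1 / 2) * besselJ (α j - 1 / 2) (x j * y j))

/-- The Hankel transform `h_α f(x) = ∫ φ_y^α(x) f(y) y^{2α} dy`. -/
def hankel (d : ℕ) (α : Fin d → ℝ) (f : (Fin d → ℝ) → ℝ) (x : Fin d → ℝ) : ℝ :=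
  ∫ y, phiFn d α y x * f y ∂(wMeasure d α)

/-- The Euclidean norm on `Fin d → ℝ`. -/
def eNorm (d : ℕ) (x : Fin d → ℝ) : ℝ := Real.sqrt (∑ j, (x j) ^ 2)

/-- The `i`-th Bessel–Riesz transform
`R_{α,i} f(x) = -x_i h_{α+e_i}((1/|y|) h_α f(y))(x)`. -/
def riesz (d : ℕ) (α : Fin d → ℝ) (i : Fin d) (f : (Fin d → ℝ) → ℝ)
    (x : Fin d → ℝ) : ℝ :=
  -(x i) * hankel d (α + Pi.single i 1) (fun y => (1 / eNorm d y) * hankel d α f y) x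

/-- The Bessel–Poisson semigroup `P_t^α f = h_α(e^{-|·|t} h_α f)`. -/
def poissonH (d : ℕ) (α : Fin d → ℝ) (t : ℝ) (f : (Fin d → ℝ) → ℝ) :
    (Fin d → ℝ) → ℝ :=
  hankel d α (fun y => Real.exp (-(eNorm d y) * t) * hankel d α f y)

/-- The `i`-th conjugate Poisson semigroup
`ℙ_t^{α,i} g(x) = x_i h_{α+e_i}(e^{-|y|t} h_{α+e_i}(g(·)/·_i)(y))(x)`. -/
def conjPoissonH (d : ℕ) (α : Fin d → ℝ) (i : Fin d) (t : ℝ)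
    (g : (Fin d → ℝ) → ℝ) (x : Fin d → ℝ) : ℝ :=
  x i * hankel d (α + Pi.single i 1)
    (fun y => Real.exp (-(eNorm d y) * t) *
      hankel d (α + Pi.single i 1) (fun z => g z / z i) y) x

/-- The Bessel heat kernel `𝒲_t^α(x,y)`. -/
def heatK (d : ℕ) (α : Fin d → ℝ) (t : ℝ) (x y : Fin d → ℝ) : ℝ :=
  (2 * t) ^ (-(∑ j, α j) - (d : ℝ) / 2) *
    Real.exp (-((eNorm d x) ^ 2 + (eNorm d y) ^ 2) / (4 * t)) *
    ∏ j, ((x j * y j / (2 * t)) ^ (-(α j) + 1 / 2) *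
      besselI (α j - 1 / 2) (x j * y j / (2 * t)))

/-- The Bessel–Poisson kernel `𝒫_t^α(x,y)` obtained by subordination. -/
def poissonK (d : ℕ) (α : Fin d → ℝ) (t : ℝ) (x y : Fin d → ℝ) : ℝ :=
  (t / Real.sqrt (2 * Real.pi)) *
    ∫ u in Set.Ioi (0 : ℝ),
      u ^ (-(3 : ℝ) / 2) * Real.exp (-(t ^ 2) / (4 * u)) * heatK d α u x y

/-- The Poisson semigroup defined through the Poisson kernel. -/
def poissonOp (d : ℕ) (α : Fin d → ℝ) (t : ℝ) (f : (Fin d → ℝ) → ℝ)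
    (x : Fin d → ℝ) : ℝ :=
  ∫ y, poissonK d α t x y * f y ∂(wMeasure d α)

/-- The partial derivative in the `i`-th coordinate. -/
def pd (d : ℕ) (i : Fin d) (F : (Fin d → ℝ) → ℝ) (x : Fin d → ℝ) : ℝ :=
  deriv (fun s => F (Function.update x i s)) (x i)

/-- Smooth compactly supported functions on `(0,∞)^d`. -/
def CcInfPos (d : ℕ) (f : (Fin d → ℝ) → ℝ) : Prop :=
  ContDiff ℝ (⊤ : ℕ∞) f ∧ HasCompactSupport f ∧ tsupport f ⊆ posOrth d

/-- The inverse-Gamma integral, obtained from the Gamma integral by `u ↦ u⁻¹`. -/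
theorem integral_rpow_mul_exp_neg_div {s c : ℝ} (hs : 0 < s) (hc : 0 < c) :
    ∫ u in Ioi (0 : ℝ), u ^ (-s - 1) * Real.exp (-c / u) = c ^ (-s) * Real.Gamma s := by
  have h := integral_comp_rpow_Ioi (fun w : ℝ => w ^ (s - 1) * Real.exp (-(c * w)))
    (p := -1) (by norm_num)
  rw [Real.integral_rpow_mul_exp_neg_mul_Ioi hs hc] at h
  rw [one_div, inv_rpow hc.le, ← rpow_neg hc.le] at h
  rw [← h]
  refine setIntegral_congr_fun measurableSet_Ioi fun u (hu : 0 < u) => ?_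
  simp only [smul_eq_mul, abs_neg, abs_one, one_mul]
  rw [← rpow_mul hu.le, ← mul_assoc, ← rpow_add hu, rpow_neg_one]
  congr 2
  · ring
  · ring

theorem integrableOn_rpow_mul_exp_neg_div {s c : ℝ} (hs : 0 < s) (hc : 0 < c) :
    IntegrableOn (fun u : ℝ => u ^ (-s - 1) * Real.exp (-c / u)) (Ioi 0) := by
  refine .of_integral_ne_zero ?_
  rw [integral_rpow_mul_exp_neg_div hs hc]
  have := Real.Gamma_pos_of_pos hs
  positivity

/-- The profile of `t ∂_t` applied to the subordination density, after scaling. -/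
def subordProfile (v : ℝ) : ℝ :=
  (1 - 1 / (2 * v)) * (v ^ (-(3 : ℝ) / 2) * Real.exp (-1 / (4 * v)))

theorem subordProfile_eq {v : ℝ} (hv : 0 < v) :
    subordProfile v = v ^ (-(1 / 2 : ℝ) - 1) * Real.exp (-(1 / 4) / v)
      - 1 / 2 * (v ^ (-(3 / 2 : ℝ) - 1) * Real.exp (-(1 / 4) / v)) := by
  have h1 : v ^ (-(3 / 2 : ℝ) - 1) = v ^ (-(3 : ℝ) / 2) / v := by
    rw [rpow_sub_one hv.ne']; ring_nf
  have h2 : (-(1 / 2 : ℝ) - 1) = -(3 : ℝ) / 2 := by norm_num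
  have h3 : (-1 : ℝ) / (4 * v) = -(1 / 4) / v := by field_simp
  rw [h1, h2, subordProfile, h3]
  field_simp

theorem integrableOn_subordProfile : IntegrableOn subordProfile (Ioi 0) := by
  refine IntegrableOn.congr_fun ?_ (fun v hv => (subordProfile_eq hv).symm) measurableSet_Ioi
  exact (integrableOn_rpow_mul_exp_neg_div (by norm_num) (by norm_num)).sub
    ((integrableOn_rpow_mul_exp_neg_div (by norm_num) (by norm_num)).const_mul _)

theorem integral_subordProfile : ∫ v in Ioi (0 : ℝ), subordProfile v = 0 := by
  rw [setIntegral_congr_fun measurableSet_Ioi fun v hv => subordProfile_eq hv,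
    integral_sub (integrableOn_rpow_mul_exp_neg_div (by norm_num) (by norm_num))
      ((integrableOn_rpow_mul_exp_neg_div (by norm_num) (by norm_num)).const_mul _),
    integral_const_mul, integral_rpow_mul_exp_neg_div (by norm_num) (by norm_num),
    integral_rpow_mul_exp_neg_div (by norm_num) (by norm_num)]
  have h : Real.Gamma (3 / 2) = 1 / 2 * Real.Gamma (1 / 2) := by
    rw [← Real.Gamma_add_one (by norm_num)]; norm_num
  have h' : ((1 / 4 : ℝ)) ^ (-(3 / 2 : ℝ)) = 4 * (1 / 4 : ℝ) ^ (-(1 / 2 : ℝ)) := by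
    rw [show -(3 / 2 : ℝ) = -(1 / 2) - 1 by norm_num, rpow_sub_one (by norm_num)]
    ring
  rw [h, h']
  ring

theorem aestronglyMeasurable_mul_subord {g : ℝ → ℝ}
    (hg : AEStronglyMeasurable g (volume.restrict (Ioi 0))) {φ : ℝ → ℝ} (hφ : Measurable φ) :
    AEStronglyMeasurable (fun u => φ u * g u) (volume.restrict (Ioi 0)) :=
  hφ.aestronglyMeasurable.mul hg

theorem integrableOn_subord_mul {g : ℝ → ℝ} {C : ℝ}
    (hg : AEStronglyMeasurable g (volume.restrict (Ioi 0))) (hC : ∀ u, 0 < u → |g u| ≤ C)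
    {t : ℝ} (ht : 0 < t) :
    IntegrableOn (fun u => u ^ (-(3 : ℝ) / 2) * Real.exp (-(t ^ 2) / (4 * u)) * g u)
      (Ioi 0) := by
  have h : IntegrableOn (fun u : ℝ => u ^ (-(3 : ℝ) / 2) * Real.exp (-(t ^ 2) / (4 * u)))
      (Ioi 0) := by
    refine (integrableOn_rpow_mul_exp_neg_div (s := 1 / 2) (c := t ^ 2 / 4) (by norm_num)
      (by positivity)).congr_fun (fun u (hu : 0 < u) => ?_) measurableSet_Ioi
    simp only
    congr 2
    · norm_num
    · field_simp
  exact Integrable.mul_bdd h hg (c := C)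
    ((ae_restrict_iff' measurableSet_Ioi).2 (ae_of_all _ fun u hu => hC u hu))

theorem hasDerivAt_subord {g : ℝ → ℝ} {C : ℝ}
    (hg : AEStronglyMeasurable g (volume.restrict (Ioi 0))) (hC : ∀ u, 0 < u → |g u| ≤ C)
    {t : ℝ} (ht : 0 < t) :
    IntegrableOn (fun u => u ^ (-(3 : ℝ) / 2) *
      (Real.exp (-(t ^ 2) / (4 * u)) * (-(2 * t) / (4 * u))) * g u) (Ioi 0) ∧ HasDerivAt
      (fun s => ∫ u in Ioi (0 : ℝ), u ^ (-(3 : ℝ) / 2) * Real.exp (-(s ^ 2) / (4 * u)) * g u)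
      (∫ u in Ioi (0 : ℝ),
        u ^ (-(3 : ℝ) / 2) * (Real.exp (-(t ^ 2) / (4 * u)) * (-(2 * t) / (4 * u))) * g u) t := by
  have hC0 : 0 ≤ C := (abs_nonneg _).trans (hC 1 one_pos)
  refine hasDerivAt_integral_of_dominated_loc_of_deriv_le (μ := volume.restrict (Ioi (0 : ℝ)))
    (F := fun s u => u ^ (-(3 : ℝ) / 2) * Real.exp (-(s ^ 2) / (4 * u)) * g u)
    (F' := fun s u => u ^ (-(3 : ℝ) / 2) *
      (Real.exp (-(s ^ 2) / (4 * u)) * (-(2 * s) / (4 * u))) * g u)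
    (s := Ioo (t / 2) (2 * t))
    (bound := fun u => t * C * (u ^ (-(3 / 2 : ℝ) - 1) * Real.exp (-(t ^ 2 / 16) / u)))
    (Ioo_mem_nhds (by linarith) (by linarith)) ?_ (integrableOn_subord_mul hg hC ht)
    ?_ ?_ ?_ ?_
  · exact .of_forall fun s => aestronglyMeasurable_mul_subord hg (by fun_prop)
  · exact aestronglyMeasurable_mul_subord hg (by fun_prop)
  · refine (ae_restrict_iff' measurableSet_Ioi).2 (ae_of_all _ fun u (hu : 0 < u) s hs => ?_)
    have hs0 : 0 < s := lt_trans (by linarith) hs.1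
    have h1 : u ^ (-(3 / 2 : ℝ) - 1) = u ^ (-(3 : ℝ) / 2) / u := by
      rw [rpow_sub_one hu.ne']; ring_nf
    have h2 : Real.exp (-(s ^ 2) / (4 * u)) ≤ Real.exp (-(t ^ 2 / 16) / u) := by
      apply Real.exp_le_exp.2
      rw [div_le_div_iff₀ (by positivity) hu]
      have : (t / 2) ^ 2 ≤ s ^ 2 := by have := hs.1; gcongr
      nlinarith
    have h3 : |(-(2 * s) / (4 * u))| ≤ t / u := by
      rw [abs_div, abs_neg, abs_of_pos (by positivity : 0 < 2 * s),
        abs_of_pos (by positivity : 0 < 4 * u), div_le_div_iff₀ (by positivity) hu]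
      have := hs.2
      nlinarith
    rw [h1, Real.norm_eq_abs, abs_mul, abs_mul, abs_mul, abs_of_pos (rpow_pos_of_pos hu _),
      Real.abs_exp]
    calc _ ≤ u ^ (-(3 : ℝ) / 2) * (Real.exp (-(t ^ 2 / 16) / u) * (t / u)) * C := by
          gcongr
          exact hC u hu
      _ = _ := by ring
  · exact (integrableOn_rpow_mul_exp_neg_div (by norm_num) (by positivity)).const_mul _
  · refine ae_of_all _ fun u s _ => ?_
    have h := (((hasDerivAt_pow 2 s).neg.div_const (4 * u)).exp.const_mul
      (u ^ (-(3 : ℝ) / 2))).mul_const (g u)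
    simpa using h

theorem mul_deriv_subord {g : ℝ → ℝ} {C : ℝ}
    (hg : AEStronglyMeasurable g (volume.restrict (Ioi 0))) (hC : ∀ u, 0 < u → |g u| ≤ C)
    {t : ℝ} (ht : 0 < t) :
    t * deriv (fun s => s / Real.sqrt (2 * Real.pi) *
      ∫ u in Ioi (0 : ℝ), u ^ (-(3 : ℝ) / 2) * Real.exp (-(s ^ 2) / (4 * u)) * g u) t =
      1 / Real.sqrt (2 * Real.pi) * ∫ v in Ioi (0 : ℝ), subordProfile v * g (t ^ 2 * v) := by
  have hint := integrableOn_subord_mul hg hC ht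
  obtain ⟨hint', hderiv⟩ := hasDerivAt_subord hg hC ht
  have hd : HasDerivAt (fun s => s / Real.sqrt (2 * Real.pi) * ∫ u in Ioi (0 : ℝ),
      u ^ (-(3 : ℝ) / 2) * Real.exp (-(s ^ 2) / (4 * u)) * g u) _ t :=
    ((hasDerivAt_id t).div_const (Real.sqrt (2 * Real.pi))).mul hderiv
  have hscale := integral_comp_mul_left_Ioi (fun u => subordProfile (u / t ^ 2) * g u) 0
    (b := t ^ 2) (by positivity)
  simp only [mul_zero, smul_eq_mul, mul_div_cancel_left₀ _ (pow_pos ht 2).ne'] at hscale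
  have hsum : ∫ u in Ioi (0 : ℝ), subordProfile (u / t ^ 2) * g u =
      t ^ 2 * (t * (∫ u in Ioi (0 : ℝ),
        u ^ (-(3 : ℝ) / 2) * Real.exp (-(t ^ 2) / (4 * u)) * g u) +
      t ^ 2 * ∫ u in Ioi (0 : ℝ), u ^ (-(3 : ℝ) / 2) *
        (Real.exp (-(t ^ 2) / (4 * u)) * (-(2 * t) / (4 * u))) * g u) := by
    rw [← integral_const_mul, ← integral_const_mul,
      ← integral_add (hint.const_mul _) (hint'.const_mul _), ← integral_const_mul]
    refine setIntegral_congr_fun measurableSet_Ioi fun u (hu : 0 < u) => ?_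
    have h1 : (u / t ^ 2) ^ (-(3 : ℝ) / 2) = u ^ (-(3 : ℝ) / 2) * t ^ 3 := by
      rw [div_rpow hu.le (by positivity), ← rpow_natCast t 2, ← rpow_mul ht.le,
        div_eq_mul_inv, ← rpow_neg ht.le, ← rpow_natCast t 3]
      norm_num
    have h2 : -1 / (4 * (u / t ^ 2)) = -(t ^ 2) / (4 * u) := by field_simp
    simp only [subordProfile, h1, h2]
    field_simp
    ring
  rw [hd.deriv, hscale, hsum, id]
  field_simp

theorem tendsto_mul_deriv_subord {g : ℝ → ℝ} {C L : ℝ}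
    (hg : StronglyMeasurable g) (hC : ∀ u, 0 < u → |g u| ≤ C)
    (hL : Tendsto g (nhdsWithin 0 (Ioi 0)) (nhds L)) :
    Tendsto (fun t => t * deriv (fun s => s / Real.sqrt (2 * Real.pi) *
      ∫ u in Ioi (0 : ℝ), u ^ (-(3 : ℝ) / 2) * Real.exp (-(s ^ 2) / (4 * u)) * g u) t)
      (nhdsWithin 0 (Ioi 0)) (nhds 0) := by
  have key : Tendsto (fun t : ℝ => ∫ v in Ioi (0 : ℝ), subordProfile v * g (t ^ 2 * v))
      (nhdsWithin 0 (Ioi 0)) (nhds (∫ v in Ioi (0 : ℝ), subordProfile v * L)) := by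
    refine tendsto_integral_filter_of_dominated_convergence (fun v => ‖subordProfile v‖ * C)
      ?_ ?_ (integrableOn_subordProfile.norm.mul_const C) ?_
    · refine .of_forall fun t => integrableOn_subordProfile.aestronglyMeasurable.mul ?_
      exact (hg.comp_measurable (by fun_prop)).aestronglyMeasurable
    · filter_upwards [self_mem_nhdsWithin] with t (ht : 0 < t)
      refine (ae_restrict_iff' measurableSet_Ioi).2 (ae_of_all _ fun v (hv : 0 < v) => ?_)
      rw [norm_mul]
      gcongr
      exact hC _ (by positivity)
    · refine (ae_restrict_iff' measurableSet_Ioi).2 (ae_of_all _ fun v (hv : 0 < v) => ?_)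
      refine (hL.comp (tendsto_nhdsWithin_iff.2 ⟨?_, ?_⟩)).const_mul _
      · have : Tendsto (fun t : ℝ => t ^ 2 * v) (nhds 0) (nhds (0 ^ 2 * v)) :=
          Continuous.tendsto (by fun_prop) 0
        simpa using this.mono_left nhdsWithin_le_nhds
      · filter_upwards [self_mem_nhdsWithin] with t (ht : 0 < t)
        exact mem_Ioi.2 (by positivity)
  rw [integral_mul_const, integral_subordProfile, zero_mul] at key
  have := key.const_mul (1 / Real.sqrt (2 * Real.pi))
  rw [mul_zero] at this
  refine this.congr' ?_
  filter_upwards [self_mem_nhdsWithin] with t ht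
  exact (mul_deriv_subord hg.aestronglyMeasurable hC ht).symm

/-- A series of nonnegative functions may be integrated termwise as soon as the series of the
integrals converges. -/
theorem integrable_tsum_of_nonneg {X : Type*} [MeasurableSpace X] {μ : Measure X}
    {F : ℕ → X → ℝ} (hF : ∀ k, Integrable (F k) μ) (h0 : ∀ k y, 0 ≤ F k y) {S : ℝ}
    (hS : HasSum (fun k => ∫ y, F k y ∂μ) S) :
    Integrable (fun y => ∑' k, F k y) μ ∧ ∫ y, ∑' k, F k y ∂μ = S := by
  have hnn : ∀ k, 0 ≤ ∫ y, F k y ∂μ := fun k => integral_nonneg (h0 k)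
  have hmeas : AEMeasurable (fun y => ∑' k, ENNReal.ofReal (F k y)) μ :=
    AEMeasurable.tsum fun k => (hF k).aemeasurable.ennreal_ofReal
  have hlint : ∫⁻ y, ∑' k, ENNReal.ofReal (F k y) ∂μ = ENNReal.ofReal S := by
    rw [lintegral_tsum fun k => (hF k).aemeasurable.ennreal_ofReal, ← hS.tsum_eq,
      ENNReal.ofReal_tsum_of_nonneg hnn hS.summable]
    exact tsum_congr fun k => (ofReal_integral_eq_lintegral_ofReal (hF k)
      (ae_of_all _ (h0 k))).symm
  have heq : ∀ y, ∑' k, F k y = (∑' k, ENNReal.ofReal (F k y)).toReal := fun y => by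
    rw [ENNReal.tsum_toReal_eq fun _ => ENNReal.ofReal_ne_top]
    exact tsum_congr fun k => (ENNReal.toReal_ofReal (h0 k y)).symm
  have hfin : ∫⁻ y, ∑' k, ENNReal.ofReal (F k y) ∂μ ≠ ∞ := by
    rw [hlint]; exact ENNReal.ofReal_ne_top
  simp_rw [heq]
  refine ⟨integrable_toReal_of_lintegral_ne_top hmeas hfin, ?_⟩
  rw [integral_toReal hmeas (ae_lt_top' hmeas hfin), hlint, ENNReal.toReal_ofReal]
  rw [← hS.tsum_eq]
  exact tsum_nonneg hnn

/-- The `k`-th term of the power series of the one-dimensional Bessel heat kernel, multiplied by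
the density of the measure; here `a = α + 1/2`. -/
def besselHeatTerm (a x : ℝ) (k : ℕ) (u y : ℝ) : ℝ :=
  if 0 < u ∧ 0 < y then
    Real.exp (-(x ^ 2 / (4 * u))) * ((x ^ 2 / (4 * u)) ^ k / k.factorial) *
      (2 * (4 * u) ^ (-(k + a)) / Real.Gamma (k + a) *
        (y ^ (2 * (k + a) - 1) * Real.exp (-(1 / (4 * u)) * y ^ (2 : ℝ))))
  else 0

/-- The one-dimensional Bessel heat kernel multiplied by the density of the measure. -/
def besselHeatDensity (a x u y : ℝ) : ℝ := ∑' k, besselHeatTerm a x k u y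

theorem besselHeatTerm_nonneg {a : ℝ} (ha : 0 < a) (x : ℝ) (k : ℕ) (u y : ℝ) :
    0 ≤ besselHeatTerm a x k u y := by
  unfold besselHeatTerm
  split_ifs with h
  · obtain ⟨hu, hy⟩ := h
    have := Real.Gamma_pos_of_pos (show 0 < k + a by positivity)
    positivity
  · exact le_rfl

theorem besselHeatDensity_nonneg {a : ℝ} (ha : 0 < a) (x u y : ℝ) :
    0 ≤ besselHeatDensity a x u y :=
  tsum_nonneg fun k => besselHeatTerm_nonneg ha x k u y

theorem measurable_besselHeatDensity (a x : ℝ) :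
    Measurable fun p : ℝ × ℝ => besselHeatDensity a x p.1 p.2 := by
  refine Measurable.tsum fun k => ?_
  refine Measurable.ite ?_ (by fun_prop) measurable_const
  exact (measurableSet_lt measurable_const measurable_fst).inter
    (measurableSet_lt measurable_const measurable_snd)

/-- Moments of the generalized Gamma density `y ^ (2b-1) exp (-y²/(4u))`. -/
theorem integral_gamma_density_moment {b u : ℝ} (hb : 0 < b) (hu : 0 < u) (m : ℕ) :
    IntegrableOn (fun y : ℝ => (y ^ 2) ^ m *
      (y ^ (2 * b - 1) * Real.exp (-(1 / (4 * u)) * y ^ (2 : ℝ)))) (Ioi 0) ∧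
    ∫ y in Ioi (0 : ℝ), (y ^ 2) ^ m *
      (y ^ (2 * b - 1) * Real.exp (-(1 / (4 * u)) * y ^ (2 : ℝ))) =
      1 / 2 * (4 * u) ^ m * ((4 * u) ^ b * Real.Gamma (b + m)) := by
  have hq : -1 < 2 * (b + m) - 1 := by
    have : (0 : ℝ) ≤ m := m.cast_nonneg
    linarith
  have hc : 0 < 1 / (4 * u) := by positivity
  have heq : ∀ y ∈ Ioi (0 : ℝ), y ^ (2 * (b + m) - 1) * Real.exp (-(1 / (4 * u)) * y ^ (2 : ℝ)) =
      (y ^ 2) ^ m * (y ^ (2 * b - 1) * Real.exp (-(1 / (4 * u)) * y ^ (2 : ℝ))) := by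
    intro y (hy : 0 < y)
    rw [← mul_assoc, ← pow_mul, ← rpow_natCast y, ← rpow_add hy]
    congr 2
    push_cast
    ring
  refine ⟨(integrableOn_rpow_mul_exp_neg_mul_rpow hq two_pos hc).congr_fun heq
    measurableSet_Ioi, ?_⟩
  rw [← setIntegral_congr_fun measurableSet_Ioi heq,
    integral_rpow_mul_exp_neg_mul_rpow two_pos hq hc]
  have h1 : (2 * (b + m) - 1 + 1) / 2 = b + m := by ring
  have h2 : -(2 * (b + m) - 1 + 1) / 2 = -(b + m) := by ring
  rw [h1, h2, one_div, inv_rpow (by positivity), rpow_neg (by positivity), inv_inv,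
    rpow_add (by positivity), rpow_natCast]
  ring

theorem besselHeatTerm_eq_indicator (a x : ℝ) (k : ℕ) {u : ℝ} (hu : 0 < u) (p : ℝ → ℝ) :
    (fun y => p y * besselHeatTerm a x k u y) = (Ioi (0 : ℝ)).indicator fun y =>
      Real.exp (-(x ^ 2 / (4 * u))) * ((x ^ 2 / (4 * u)) ^ k / k.factorial) *
      (2 * (4 * u) ^ (-(k + a)) / Real.Gamma (k + a)) *
        (p y * (y ^ (2 * (k + a) - 1) * Real.exp (-(1 / (4 * u)) * y ^ (2 : ℝ)))) := by
  funext y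
  by_cases hy : 0 < y
  · simp only [besselHeatTerm, hu, hy, and_self, if_true, indicator_of_mem (mem_Ioi.2 hy)]
    ring
  · simp [besselHeatTerm, hy]

theorem integral_besselHeatTerm {a : ℝ} (ha : 0 < a) (x : ℝ) (k : ℕ) {u : ℝ} (hu : 0 < u) :
    Integrable (besselHeatTerm a x k u) ∧ ∫ y, besselHeatTerm a x k u y =
      Real.exp (-(x ^ 2 / (4 * u))) * ((x ^ 2 / (4 * u)) ^ k / k.factorial) := by
  have h := besselHeatTerm_eq_indicator a x k hu 1
  simp only [Pi.one_apply, one_mul] at h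
  change besselHeatTerm a x k u = _ at h
  obtain ⟨hi, hv⟩ := integral_gamma_density_moment (b := k + a) (by positivity) hu 0
  simp only [pow_zero, one_mul] at hi hv
  refine ⟨?_, ?_⟩
  · rw [h, integrable_indicator_iff measurableSet_Ioi]
    exact hi.const_mul _
  · rw [h, integral_indicator measurableSet_Ioi, integral_const_mul, hv,
      rpow_neg (by positivity)]
    have := Real.Gamma_pos_of_pos (show 0 < k + a by positivity)
    have : 0 < (4 * u) ^ (k + a) := by positivity
    simp only [Nat.cast_zero, add_zero]
    field_simp

theorem integral_sq_sub_besselHeatTerm {a : ℝ} (ha : 0 < a) (x : ℝ) (k : ℕ) {u : ℝ}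
    (hu : 0 < u) :
    Integrable (fun y => (y ^ 2 - x ^ 2) ^ 2 * besselHeatTerm a x k u y) ∧
    ∫ y, (y ^ 2 - x ^ 2) ^ 2 * besselHeatTerm a x k u y =
      Real.exp (-(x ^ 2 / (4 * u))) * ((x ^ 2 / (4 * u)) ^ k / k.factorial) *
        ((4 * u) ^ 2 * ((k + a - x ^ 2 / (4 * u)) ^ 2 + (k + a))) := by
  have hb : 0 < k + a := by positivity
  obtain ⟨hi0, hv0⟩ := integral_gamma_density_moment hb hu 0
  obtain ⟨hi1, hv1⟩ := integral_gamma_density_moment hb hu 1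
  obtain ⟨hi2, hv2⟩ := integral_gamma_density_moment hb hu 2
  have hG : Real.Gamma (k + a + 1) = (k + a) * Real.Gamma (k + a) :=
    Real.Gamma_add_one hb.ne'
  have hG2 : Real.Gamma (k + a + 2) = (k + a + 1) * ((k + a) * Real.Gamma (k + a)) := by
    rw [← hG, ← Real.Gamma_add_one (by positivity)]; congr 1; ring
  have hexp : (fun y : ℝ => (y ^ 2 - x ^ 2) ^ 2 *
      (y ^ (2 * (k + a) - 1) * Real.exp (-(1 / (4 * u)) * y ^ (2 : ℝ)))) = fun y =>
      ((y ^ 2) ^ 2 * (y ^ (2 * (k + a) - 1) * Real.exp (-(1 / (4 * u)) * y ^ (2 : ℝ))) -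
      2 * x ^ 2 * ((y ^ 2) ^ 1 *
        (y ^ (2 * (k + a) - 1) * Real.exp (-(1 / (4 * u)) * y ^ (2 : ℝ))))) +
      x ^ 4 * ((y ^ 2) ^ 0 *
        (y ^ (2 * (k + a) - 1) * Real.exp (-(1 / (4 * u)) * y ^ (2 : ℝ)))) := by
    funext y; ring
  have hd : IntegrableOn (fun y : ℝ =>
      (y ^ 2) ^ 2 * (y ^ (2 * (k + a) - 1) * Real.exp (-(1 / (4 * u)) * y ^ (2 : ℝ))) -
      2 * x ^ 2 * ((y ^ 2) ^ 1 *
        (y ^ (2 * (k + a) - 1) * Real.exp (-(1 / (4 * u)) * y ^ (2 : ℝ))))) (Ioi 0) :=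
    hi2.sub (hi1.const_mul _)
  rw [besselHeatTerm_eq_indicator a x k hu]
  refine ⟨?_, ?_⟩
  · rw [integrable_indicator_iff measurableSet_Ioi]
    refine Integrable.const_mul ?_ _
    rw [hexp]
    exact hd.add (hi0.const_mul _)
  · rw [integral_indicator measurableSet_Ioi, integral_const_mul, hexp,
      integral_add hd (hi0.const_mul _),
      integral_sub hi2 (hi1.const_mul _), integral_const_mul, integral_const_mul,
      hv0, hv1, hv2, rpow_neg (by positivity)]
    have := Real.Gamma_pos_of_pos hb
    have : 0 < (4 * u) ^ (k + a) := by positivity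
    simp only [Nat.cast_zero, add_zero, Nat.cast_one, Nat.cast_ofNat, hG, hG2]
    field_simp
    ring

theorem hasSum_poisson_weight (l : ℝ) :
    HasSum (fun k : ℕ => Real.exp (-l) * (l ^ k / k.factorial)) 1 := by
  have h := (NormedSpace.expSeries_div_hasSum_exp l).mul_left (Real.exp (-l))
  rwa [← Real.exp_eq_exp_ℝ, ← Real.exp_add, neg_add_cancel, Real.exp_zero] at h

theorem hasSum_poisson_weight_mul {l S : ℝ} {p : ℝ → ℝ}
    (h : HasSum (fun k : ℕ => Real.exp (-l) * (l ^ k / k.factorial) * p (k + 1)) S) :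
    HasSum (fun k : ℕ => Real.exp (-l) * (l ^ k / k.factorial) * (k * p k)) (l * S) := by
  rw [← hasSum_nat_add_iff' 1]
  simp only [Finset.range_one, Finset.sum_singleton, Nat.cast_zero, zero_mul, mul_zero, sub_zero]
  refine (h.mul_left l).congr_fun fun k => ?_
  rw [Nat.factorial_succ]
  push_cast
  field_simp
  ring

theorem hasSum_poisson_weight_sq (l a : ℝ) :
    HasSum (fun k : ℕ => Real.exp (-l) * (l ^ k / k.factorial) *
      ((k + a - l) ^ 2 + (k + a))) (2 * l + a ^ 2 + a) := by
  have h0 := hasSum_poisson_weight l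
  have h1 := hasSum_poisson_weight_mul (p := fun _ => 1) (by simpa using h0)
  have h2 := hasSum_poisson_weight_mul (p := fun s => s - 1) (l := l) (S := l) (by
    simpa using h1)
  have h := (h2.add (h1.mul_left (2 * a - 2 * l + 2))).add (h0.mul_left ((a - l) ^ 2 + a))
  convert h using 1
  · funext k; ring
  · ring

theorem integral_besselHeatDensity {a : ℝ} (ha : 0 < a) (x : ℝ) {u : ℝ} (hu : 0 < u) :
    Integrable (besselHeatDensity a x u) ∧ ∫ y, besselHeatDensity a x u y = 1 := by
  refine integrable_tsum_of_nonneg (fun k => (integral_besselHeatTerm ha x k hu).1)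
    (fun k => besselHeatTerm_nonneg ha x k u) ?_
  simp only [(integral_besselHeatTerm ha x _ hu).2]
  exact hasSum_poisson_weight _

theorem integral_sq_sub_besselHeatDensity {a : ℝ} (ha : 0 < a) (x : ℝ) {u : ℝ} (hu : 0 < u) :
    Integrable (fun y => (y ^ 2 - x ^ 2) ^ 2 * besselHeatDensity a x u y) ∧
    ∫ y, (y ^ 2 - x ^ 2) ^ 2 * besselHeatDensity a x u y =
      (4 * u) ^ 2 * (2 * (x ^ 2 / (4 * u)) + a ^ 2 + a) := by
  simp only [besselHeatDensity, ← tsum_mul_left]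
  refine integrable_tsum_of_nonneg (fun k => (integral_sq_sub_besselHeatTerm ha x k hu).1)
    (fun k y => mul_nonneg (sq_nonneg _) (besselHeatTerm_nonneg ha x k u y)) ?_
  simp only [(integral_sq_sub_besselHeatTerm ha x _ hu).2]
  refine ((hasSum_poisson_weight_sq (x ^ 2 / (4 * u)) a).mul_left ((4 * u) ^ 2)).congr_fun
    fun k => ?_
  ring

theorem besselHeat_rpow_identity {α x u y : ℝ} (k : ℕ) (hx : 0 < x) (hu : 0 < u)
    (hy : 0 < y) :
    (2 * u) ^ (-α - 1 / 2) * ((x * y / (2 * u)) ^ (-α + 1 / 2) *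
      (x * y / (2 * u) / 2) ^ (2 * (k : ℝ) + (α - 1 / 2))) * y ^ (2 * α) =
    (x ^ 2 / (4 * u)) ^ k * (2 * (4 * u) ^ (-(k + (α + 1 / 2))) *
      y ^ (2 * (k + (α + 1 / 2)) - 1)) := by
  apply Real.log_injOn_pos (mem_Ioi.2 (by positivity)) (mem_Ioi.2 (by positivity))
  have h4 : Real.log 4 = 2 * Real.log 2 := by
    rw [show (4 : ℝ) = 2 ^ 2 by norm_num, Real.log_pow]; norm_num
  rw [Real.log_mul (by positivity) (by positivity), Real.log_mul (by positivity) (by positivity),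
    Real.log_mul (by positivity) (by positivity), Real.log_mul (by positivity) (by positivity),
    Real.log_mul (by positivity) (by positivity), Real.log_mul (by positivity) (by positivity),
    Real.log_rpow (by positivity), Real.log_rpow (by positivity), Real.log_rpow (by positivity),
    Real.log_rpow (by positivity), Real.log_rpow (by positivity), Real.log_rpow (by positivity),
    Real.log_pow, Real.log_div (by positivity) (by positivity),
    Real.log_div (by positivity) (by positivity), Real.log_div (by positivity) (by positivity),
    Real.log_mul (by positivity) (by positivity), Real.log_mul (by positivity) (by positivity),
    Real.log_div (by positivity) (by positivity), Real.log_pow,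
    Real.log_mul (by positivity) (by positivity), h4]
  push_cast
  ring

theorem heat_factor_eq_besselHeatDensity {α x u y : ℝ} (hx : 0 < x) (hu : 0 < u) (hy : 0 < y) :
    (2 * u) ^ (-α - 1 / 2) * Real.exp (-(x ^ 2 + y ^ 2) / (4 * u)) *
      ((x * y / (2 * u)) ^ (-α + 1 / 2) * besselI (α - 1 / 2) (x * y / (2 * u))) *
      y ^ (2 * α) = besselHeatDensity (α + 1 / 2) x u y := by
  simp only [besselI, besselHeatDensity, ← tsum_mul_left, ← tsum_mul_right]
  refine tsum_congr fun k => ?_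
  simp only [besselHeatTerm, hu, hy, and_self, if_true]
  have hG : (k : ℝ) + (α - 1 / 2) + 1 = k + (α + 1 / 2) := by ring
  have hexp : Real.exp (-(x ^ 2 + y ^ 2) / (4 * u)) =
      Real.exp (-(x ^ 2 / (4 * u))) * Real.exp (-(1 / (4 * u)) * y ^ (2 : ℝ)) := by
    rw [← Real.exp_add, rpow_two]
    congr 1
    ring
  rw [hG, hexp]
  linear_combination (Real.exp (-(x ^ 2 / (4 * u))) * Real.exp (-(1 / (4 * u)) * y ^ (2 : ℝ)) *
    (1 / (k.factorial * Real.Gamma (k + (α + 1 / 2))))) *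
    besselHeat_rpow_identity (α := α) k hx hu hy

theorem posOrth_eq_pi (d : ℕ) : posOrth d = Set.pi univ fun _ => Ioi 0 := by
  ext y; simp [posOrth]

theorem measurableSet_posOrth (d : ℕ) : MeasurableSet (posOrth d) := by
  rw [posOrth_eq_pi]
  exact .univ_pi fun _ => measurableSet_Ioi

/-- The Bessel heat kernel multiplied by the density of the measure, extended by zero. -/
def besselHeatDensityPi (d : ℕ) (α x : Fin d → ℝ) (u : ℝ) (y : Fin d → ℝ) : ℝ :=
  ∏ j, besselHeatDensity (α j + 1 / 2) (x j) u (y j)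

theorem measurable_besselHeatDensityPi (d : ℕ) (α x : Fin d → ℝ) :
    Measurable fun p : ℝ × (Fin d → ℝ) => besselHeatDensityPi d α x p.1 p.2 := by
  refine Finset.measurable_prod _ fun j _ => ?_
  exact (measurable_besselHeatDensity _ _).comp (f := fun p : ℝ × (Fin d → ℝ) => (p.1, p.2 j))
    (by fun_prop)

theorem besselHeatDensityPi_nonneg {d : ℕ} {α : Fin d → ℝ} (hα : ∀ j, 0 ≤ α j)
    (x : Fin d → ℝ) (u : ℝ) (y : Fin d → ℝ) : 0 ≤ besselHeatDensityPi d α x u y :=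
  Finset.prod_nonneg fun j _ => besselHeatDensity_nonneg (by linarith [hα j]) _ _ _

theorem besselHeatDensityPi_of_notMem {d : ℕ} (α x : Fin d → ℝ) (u : ℝ) {y : Fin d → ℝ}
    (hy : y ∉ posOrth d) : besselHeatDensityPi d α x u y = 0 := by
  simp only [posOrth, mem_ofPred_eq, not_forall] at hy
  obtain ⟨j, hj⟩ := hy
  refine Finset.prod_eq_zero (Finset.mem_univ j) ?_
  simp [besselHeatDensity, besselHeatTerm, hj]

theorem heatK_mul_weight {d : ℕ} {α x y : Fin d → ℝ} {u : ℝ} (hx : x ∈ posOrth d)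
    (hu : 0 < u) (hy : y ∈ posOrth d) :
    heatK d α u x y * ∏ j, y j ^ (2 * α j) = besselHeatDensityPi d α x u y := by
  have hn : ∀ z : Fin d → ℝ, eNorm d z ^ 2 = ∑ j, z j ^ 2 := fun z =>
    Real.sq_sqrt (Finset.sum_nonneg fun j _ => sq_nonneg _)
  have h1 : (2 * u) ^ (-(∑ j, α j) - (d : ℝ) / 2) = ∏ j, (2 * u) ^ (-α j - 1 / 2) := by
    rw [← Real.rpow_sum_of_pos (by positivity)]
    congr 1
    simp [Finset.sum_sub_distrib, div_eq_mul_inv]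
  have h2 : Real.exp (-(eNorm d x ^ 2 + eNorm d y ^ 2) / (4 * u)) =
      ∏ j, Real.exp (-(x j ^ 2 + y j ^ 2) / (4 * u)) := by
    rw [← Real.exp_sum, hn, hn, ← Finset.sum_add_distrib, ← Finset.sum_neg_distrib,
      Finset.sum_div]
  rw [heatK, h1, h2, ← Finset.prod_mul_distrib, ← Finset.prod_mul_distrib,
    ← Finset.prod_mul_distrib]
  exact Finset.prod_congr rfl fun j _ => heat_factor_eq_besselHeatDensity (hx j) hu (hy j)

theorem integral_besselHeatDensityPi {d : ℕ} {α : Fin d → ℝ} (hα : ∀ j, 0 ≤ α j)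
    (x : Fin d → ℝ) {u : ℝ} (hu : 0 < u) :
    Integrable (besselHeatDensityPi d α x u) ∧ ∫ y, besselHeatDensityPi d α x u y = 1 := by
  have h := fun j => integral_besselHeatDensity (a := α j + 1 / 2) (by linarith [hα j]) (x j) hu
  refine ⟨Integrable.fintype_prod fun j => (h j).1, ?_⟩
  simp only [besselHeatDensityPi]
  rw [integral_fintype_prod_volume_eq_prod
    fun j => besselHeatDensity (α j + 1 / 2) (x j) u]
  exact Finset.prod_eq_one fun j _ => (h j).2

theorem integral_sq_sub_besselHeatDensityPi {d : ℕ} {α : Fin d → ℝ} (hα : ∀ j, 0 ≤ α j)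
    (x : Fin d → ℝ) {u : ℝ} (hu : 0 < u) (i : Fin d) :
    Integrable (fun y => (y i ^ 2 - x i ^ 2) ^ 2 * besselHeatDensityPi d α x u y) ∧
    ∫ y, (y i ^ 2 - x i ^ 2) ^ 2 * besselHeatDensityPi d α x u y =
      8 * u * x i ^ 2 + 16 * u ^ 2 * ((α i + 1 / 2) ^ 2 + (α i + 1 / 2)) := by
  have ha : ∀ j, 0 < α j + 1 / 2 := fun j => by linarith [hα j]
  let φ : Fin d → ℝ → ℝ := fun j s =>
    (if j = i then (s ^ 2 - x j ^ 2) ^ 2 else 1) * besselHeatDensity (α j + 1 / 2) (x j) u s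
  have hφ : (fun y : Fin d → ℝ => (y i ^ 2 - x i ^ 2) ^ 2 * besselHeatDensityPi d α x u y) =
      fun y => ∏ j, φ j (y j) := by
    funext y
    simp only [φ, Finset.prod_mul_distrib, Finset.prod_ite_eq', Finset.mem_univ, if_true,
      besselHeatDensityPi]
  have hv : ∀ j, Integrable (φ j) ∧ ∫ s, φ j s = if j = i then
      8 * u * x j ^ 2 + 16 * u ^ 2 * ((α j + 1 / 2) ^ 2 + (α j + 1 / 2)) else 1 := by
    intro j
    by_cases hj : j = i
    · simp only [φ, hj, if_true]
      refine ⟨(integral_sq_sub_besselHeatDensity (ha i) (x i) hu).1, ?_⟩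
      rw [(integral_sq_sub_besselHeatDensity (ha i) (x i) hu).2]
      field_simp
      ring
    · simp only [φ, hj, if_false, one_mul]
      exact integral_besselHeatDensity (ha j) (x j) hu
  rw [hφ]
  refine ⟨Integrable.fintype_prod fun j => (hv j).1, ?_⟩
  rw [integral_fintype_prod_volume_eq_prod φ, Finset.prod_congr rfl fun j _ => (hv j).2]
  simp

/-- The Bessel heat semigroup applied to `f`. -/
def besselHeatOp (d : ℕ) (α : Fin d → ℝ) (f : (Fin d → ℝ) → ℝ) (x : Fin d → ℝ) (u : ℝ) : ℝ :=
  ∫ y, besselHeatDensityPi d α x u y * f y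

theorem stronglyMeasurable_besselHeatOp (d : ℕ) (α : Fin d → ℝ) {f : (Fin d → ℝ) → ℝ}
    (hf : Continuous f) (x : Fin d → ℝ) : StronglyMeasurable (besselHeatOp d α f x) :=
  StronglyMeasurable.integral_prod_right (ν := volume)
    (f := fun u y => besselHeatDensityPi d α x u y * f y)
    ((measurable_besselHeatDensityPi d α x).mul
      (hf.measurable.comp measurable_snd)).stronglyMeasurable

theorem integrable_besselHeatDensityPi_mul {d : ℕ} {α : Fin d → ℝ} (hα : ∀ j, 0 ≤ α j)
    (x : Fin d → ℝ) {f : (Fin d → ℝ) → ℝ} (hf : Continuous f) {C : ℝ} (hC : ∀ y, |f y| ≤ C)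
    {u : ℝ} (hu : 0 < u) : Integrable (fun y => besselHeatDensityPi d α x u y * f y) :=
  (integral_besselHeatDensityPi hα x hu).1.mul_bdd hf.aestronglyMeasurable (ae_of_all _ hC)

theorem abs_besselHeatOp_le {d : ℕ} {α : Fin d → ℝ} (hα : ∀ j, 0 ≤ α j) (x : Fin d → ℝ)
    {f : (Fin d → ℝ) → ℝ} {C : ℝ} (hC : ∀ y, |f y| ≤ C)
    {u : ℝ} (hu : 0 < u) : |besselHeatOp d α f x u| ≤ C := by
  obtain ⟨hi, hv⟩ := integral_besselHeatDensityPi hα x hu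
  have h := norm_integral_le_of_norm_le (hi.mul_const C) (ae_of_all volume fun y =>
    show ‖besselHeatDensityPi d α x u y * f y‖ ≤ besselHeatDensityPi d α x u y * C by
      rw [norm_mul, Real.norm_of_nonneg (besselHeatDensityPi_nonneg hα x u y)]
      exact mul_le_mul_of_nonneg_left (hC y) (besselHeatDensityPi_nonneg hα x u y))
  rwa [integral_mul_const, hv, one_mul] at h

theorem exists_abs_sub_le_sq_sub_sq {d : ℕ} {x : Fin d → ℝ} (hx : x ∈ posOrth d)
    {f : (Fin d → ℝ) → ℝ} (hf : Continuous f) {C : ℝ} (hC : ∀ y, |f y| ≤ C)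
    {ε : ℝ} (hε : 0 < ε) :
    ∃ K, ∀ y ∈ posOrth d,
      |f y - f x| ≤ ε + ∑ j, K / x j ^ 2 * (y j ^ 2 - x j ^ 2) ^ 2 := by
  have hC0 : 0 ≤ C := (abs_nonneg _).trans (hC x)
  obtain ⟨δ, hδ, hfδ⟩ := Metric.continuous_iff.1 hf x ε hε
  refine ⟨2 * C / δ ^ 2, fun y hy => ?_⟩
  have hnn : ∀ j ∈ Finset.univ,
      0 ≤ 2 * C / δ ^ 2 / x j ^ 2 * (y j ^ 2 - x j ^ 2) ^ 2 := fun j _ => by positivity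
  by_cases h : dist y x < δ
  · have h1 := hfδ y h
    rw [Real.dist_eq] at h1
    linarith [Finset.sum_nonneg hnn]
  · rw [dist_pi_lt_iff hδ] at h
    push Not at h
    obtain ⟨j, hj⟩ := h
    rw [Real.dist_eq] at hj
    have hxj : 0 < x j := hx j
    have hyj : 0 < y j := hy j
    have h1 : δ ^ 2 * x j ^ 2 ≤ (y j ^ 2 - x j ^ 2) ^ 2 := by
      have h2 : δ ^ 2 ≤ (y j - x j) ^ 2 := by rw [← sq_abs (y j - x j)]; gcongr
      have h3 : x j ^ 2 ≤ (y j + x j) ^ 2 := by gcongr; linarith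
      calc δ ^ 2 * x j ^ 2 ≤ (y j - x j) ^ 2 * (y j + x j) ^ 2 := by gcongr
        _ = _ := by ring
    have h4 : 2 * C ≤ 2 * C / δ ^ 2 / x j ^ 2 * (y j ^ 2 - x j ^ 2) ^ 2 := by
      calc 2 * C = 2 * C / δ ^ 2 / x j ^ 2 * (δ ^ 2 * x j ^ 2) := by field_simp
        _ ≤ _ := by gcongr
    have h5 := Finset.single_le_sum hnn (Finset.mem_univ j)
    have h6 : |f y - f x| ≤ 2 * C := by
      have := abs_sub (f y) (f x)
      linarith [hC y, hC x]
    linarith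

theorem tendsto_besselHeatOp {d : ℕ} {α : Fin d → ℝ} (hα : ∀ j, 0 ≤ α j) {x : Fin d → ℝ}
    (hx : x ∈ posOrth d) {f : (Fin d → ℝ) → ℝ} (hf : Continuous f) {C : ℝ}
    (hC : ∀ y, |f y| ≤ C) :
    Tendsto (besselHeatOp d α f x) (nhdsWithin 0 (Ioi 0)) (nhds (f x)) := by
  rw [Metric.tendsto_nhds]
  intro ε hε
  obtain ⟨K, hK⟩ := exists_abs_sub_le_sq_sub_sq hx hf hC (half_pos hε)
  let M : ℝ → ℝ := fun u => ∑ j, K / x j ^ 2 *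
    (8 * u * x j ^ 2 + 16 * u ^ 2 * ((α j + 1 / 2) ^ 2 + (α j + 1 / 2)))
  have hM : Tendsto M (nhdsWithin 0 (Ioi 0)) (nhds 0) := by
    have h : Continuous M := by fun_prop
    have h0 := h.tendsto 0
    simp only [M, mul_zero, zero_mul, ne_eq, OfNat.ofNat_ne_zero, not_false_eq_true, zero_pow,
      add_zero, Finset.sum_const_zero] at h0
    exact h0.mono_left nhdsWithin_le_nhds
  filter_upwards [self_mem_nhdsWithin, hM.eventually (gt_mem_nhds (half_pos hε))] with u hu hMu
  obtain ⟨hi, hv⟩ := integral_besselHeatDensityPi hα x hu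
  have hmom := fun j => integral_sq_sub_besselHeatDensityPi hα x hu j
  have heq : besselHeatOp d α f x u - f x =
      ∫ y, besselHeatDensityPi d α x u y * (f y - f x) := by
    simp only [mul_sub]
    rw [integral_sub (integrable_besselHeatDensityPi_mul hα x hf hC hu) (hi.mul_const _),
      integral_mul_const, hv, one_mul, besselHeatOp]
  have hbi : ∀ j ∈ Finset.univ, Integrable (fun y : Fin d → ℝ =>
      K / x j ^ 2 * ((y j ^ 2 - x j ^ 2) ^ 2 * besselHeatDensityPi d α x u y)) :=
    fun j _ => (hmom j).1.const_mul _
  have hle := norm_integral_le_of_norm_le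
    ((hi.const_mul (ε / 2)).add (integrable_finsetSum _ hbi)) (ae_of_all volume fun y =>
      show ‖besselHeatDensityPi d α x u y * (f y - f x)‖ ≤
        ε / 2 * besselHeatDensityPi d α x u y + ∑ j, K / x j ^ 2 *
          ((y j ^ 2 - x j ^ 2) ^ 2 * besselHeatDensityPi d α x u y) by
      by_cases hy : y ∈ posOrth d
      · have hD := besselHeatDensityPi_nonneg hα x u y
        rw [norm_mul, Real.norm_of_nonneg hD, Real.norm_eq_abs]
        refine (mul_le_mul_of_nonneg_left (hK y hy) hD).trans_eq ?_
        rw [mul_add, Finset.mul_sum]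
        congr 1
        · ring
        · exact Finset.sum_congr rfl fun j _ => by ring
      · simp [besselHeatDensityPi_of_notMem α x u hy])
  rw [Real.dist_eq, heq, ← Real.norm_eq_abs]
  refine hle.trans_lt ?_
  simp only [Pi.add_apply]
  rw [integral_add (hi.const_mul _) (integrable_finsetSum _ hbi), integral_const_mul, hv,
    integral_finsetSum _ hbi]
  simp only [integral_const_mul, (hmom _).2]
  change _ + M u < ε
  linarith

theorem integrable_subord_mul_besselHeatDensityPi {d : ℕ} {α : Fin d → ℝ}
    (hα : ∀ j, 0 ≤ α j) (x : Fin d → ℝ) {t : ℝ} (ht : 0 < t) :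
    Integrable (fun p : ℝ × (Fin d → ℝ) =>
      p.1 ^ (-(3 : ℝ) / 2) * Real.exp (-(t ^ 2) / (4 * p.1)) * besselHeatDensityPi d α x p.1 p.2)
      ((volume.restrict (Ioi (0 : ℝ))).prod volume) := by
  have hm : Measurable fun p : ℝ × (Fin d → ℝ) => p.1 ^ (-(3 : ℝ) / 2) *
      Real.exp (-(t ^ 2) / (4 * p.1)) * besselHeatDensityPi d α x p.1 p.2 :=
    Measurable.mul (by fun_prop) (measurable_besselHeatDensityPi d α x)
  rw [integrable_prod_iff hm.aestronglyMeasurable]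
  refine ⟨(ae_restrict_iff' measurableSet_Ioi).2 (ae_of_all _ fun u hu =>
    (integral_besselHeatDensityPi hα x hu).1.const_mul
      (u ^ (-(3 : ℝ) / 2) * Real.exp (-(t ^ 2) / (4 * u)))), ?_⟩
  refine (integrableOn_subord_mul (g := fun _ => 1) (C := 1) aestronglyMeasurable_const
    (fun _ _ => by simp) ht).congr_fun (fun u (hu : 0 < u) => ?_) measurableSet_Ioi
  have hk : 0 ≤ u ^ (-(3 : ℝ) / 2) * Real.exp (-(t ^ 2) / (4 * u)) := by positivity
  simp only [norm_mul _ (besselHeatDensityPi _ _ _ _ _), Real.norm_of_nonneg hk,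
    Real.norm_of_nonneg (besselHeatDensityPi_nonneg hα _ _ _)]
  rw [integral_const_mul, (integral_besselHeatDensityPi hα x hu).2]

theorem poissonOp_eq_subord {d : ℕ} {α : Fin d → ℝ} (hα : ∀ j, 0 ≤ α j) {x : Fin d → ℝ}
    (hx : x ∈ posOrth d) {f : (Fin d → ℝ) → ℝ} (hf : Continuous f) {C : ℝ}
    (hC : ∀ y, |f y| ≤ C) {t : ℝ} (ht : 0 < t) :
    poissonOp d α t f x = t / Real.sqrt (2 * Real.pi) * ∫ u in Ioi (0 : ℝ),
      u ^ (-(3 : ℝ) / 2) * Real.exp (-(t ^ 2) / (4 * u)) * besselHeatOp d α f x u := by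
  have hpt : ∀ y, (posOrth d).indicator (fun y => (∏ j, y j ^ (2 * α j)) *
      (poissonK d α t x y * f y)) y = t / Real.sqrt (2 * Real.pi) *
      ∫ u in Ioi (0 : ℝ), u ^ (-(3 : ℝ) / 2) * Real.exp (-(t ^ 2) / (4 * u)) *
        besselHeatDensityPi d α x u y * f y := by
    intro y
    by_cases hy : y ∈ posOrth d
    · rw [indicator_of_mem hy, poissonK, integral_mul_const]
      have h : ∫ u in Ioi (0 : ℝ), u ^ (-(3 : ℝ) / 2) * Real.exp (-(t ^ 2) / (4 * u)) *
          besselHeatDensityPi d α x u y =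
          (∫ u in Ioi (0 : ℝ), u ^ (-(3 : ℝ) / 2) * Real.exp (-(t ^ 2) / (4 * u)) *
            heatK d α u x y) * ∏ j, y j ^ (2 * α j) := by
        rw [← integral_mul_const]
        refine setIntegral_congr_fun measurableSet_Ioi fun u hu => ?_
        rw [← heatK_mul_weight hx hu hy]
        ring
      rw [h]
      ring
    · simp [indicator_of_notMem hy, besselHeatDensityPi_of_notMem α x _ hy]
  have hw : poissonOp d α t f x = ∫ y, (posOrth d).indicator (fun y =>
      (∏ j, y j ^ (2 * α j)) * (poissonK d α t x y * f y)) y := by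
    rw [poissonOp, wMeasure, integral_withDensity_eq_integral_toReal_smul
      (by fun_prop) (ae_of_all _ fun _ => ENNReal.ofReal_lt_top),
      integral_indicator (measurableSet_posOrth d)]
    refine setIntegral_congr_fun (measurableSet_posOrth d) fun y hy => ?_
    simp only [smul_eq_mul]
    rw [ENNReal.toReal_ofReal (Finset.prod_nonneg fun j _ => rpow_nonneg (hy j).le _)]
  simp only [hw, hpt]
  rw [integral_const_mul, ← integral_integral_swap (μ := volume.restrict (Ioi (0 : ℝ)))
    (f := fun u y => u ^ (-(3 : ℝ) / 2) * Real.exp (-(t ^ 2) / (4 * u)) *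
      besselHeatDensityPi d α x u y * f y)]
  · simp only [mul_assoc, integral_const_mul, besselHeatOp]
  · exact (integrable_subord_mul_besselHeatDensityPi hα x ht).mul_bdd (c := C)
      (hf.measurable.comp measurable_snd).aestronglyMeasurable (ae_of_all _ fun p => hC p.2)

/-- `t ∂_t P_t^α f(x) → 0` as `t → 0⁺`. -/
theorem poisson_t_deriv_tendsto_zero_at_zero (d : ℕ) (α : Fin d → ℝ)
    (hα : ∀ j, 0 ≤ α j) (f : (Fin d → ℝ) → ℝ) (hf : CcInfPos d f)
    (x : Fin d → ℝ) (hx : x ∈ posOrth d) :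
    Tendsto (fun t => t * deriv (fun s => poissonOp d α s f x) t)
      (nhdsWithin 0 (Set.Ioi 0)) (nhds 0) := by
  have hc : Continuous f := hf.1.continuous
  obtain ⟨C, hC⟩ := hf.2.1.exists_bound_of_continuous hc
  refine (tendsto_mul_deriv_subord (stronglyMeasurable_besselHeatOp d α hc x)
    (fun u hu => abs_besselHeatOp_le hα x hC hu) (tendsto_besselHeatOp hα hx hc hC)).congr' ?_
  filter_upwards [self_mem_nhdsWithin] with t ht
  congr 1
  refine Filter.EventuallyEq.deriv_eq ?_
  filter_upwards [Ioi_mem_nhds ht] with s hs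
  exact (poissonOp_eq_subord hα hx hc hC hs).symm
end
end

section
/- Let α ∈ [0,∞)^d and f ∈ C_c^∞(ℝ_+^d). Then for every x ∈ ℝ_+^d, lim_{t→+∞} t ∂_t P_t^α f(x) = 0. -/
open MeasureTheory Real Filter Set
open scoped ENNReal BigOperators

noncomputable section

lemma integrableOn_rpow_neg_mul_exp_neg_div {s b : ℝ} (hs : 1 < s) (hb : 0 < b) :
    IntegrableOn (fun u : ℝ => u ^ (-s) * Real.exp (-(b / u))) (Ioi 0) := by
  have h := integrableOn_rpow_mul_exp_neg_mul_rpow (p := 1) (s := s - 2) (by linarith)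
    one_pos hb
  refine ((integrableOn_Ioi_comp_rpow_iff' _ (p := -1) (by norm_num)).mpr h).congr_fun
    (fun u hu => ?_) measurableSet_Ioi
  have hu : (0 : ℝ) < u := hu
  simp only [smul_eq_mul, Real.rpow_one, Real.rpow_neg_one, Real.inv_rpow hu.le,
    ← Real.rpow_neg hu.le, ← mul_assoc, ← Real.rpow_add hu]
  ring_nf

lemma integral_rpow_neg_mul_exp_neg_div {s b : ℝ} (hs : 1 < s) (hb : 0 < b) :
    ∫ u in Ioi (0 : ℝ), u ^ (-s) * Real.exp (-(b / u)) =
      (1 / b) ^ (s - 1) * Real.Gamma (s - 1) := by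
  rw [← Real.integral_rpow_mul_exp_neg_mul_Ioi (by linarith) hb,
    ← integral_comp_rpow_Ioi (fun v : ℝ => v ^ (s - 1 - 1) * Real.exp (-(b * v)))
      (p := -1) (by norm_num)]
  refine setIntegral_congr_fun measurableSet_Ioi fun u hu => ?_
  have hu : (0 : ℝ) < u := hu
  simp only [smul_eq_mul, Real.rpow_neg_one, Real.inv_rpow hu.le,
    ← Real.rpow_neg hu.le, ← mul_assoc, abs_neg, abs_one, one_mul, ← Real.rpow_add hu]
  ring_nf

lemma measurable_besselI (μ : ℝ) : Measurable (besselI μ) := by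
  unfold besselI
  refine Measurable.tsum fun k => ?_
  fun_prop

lemma factorial_two_mul_mul_Gamma_le {a : ℝ} (ha : 0 ≤ a) (k : ℕ) :
    ((2 * k).factorial : ℝ) * Real.Gamma (a + 1 / 2) ≤
      4 ^ k * (k.factorial * Real.Gamma (k + (a - 1 / 2) + 1)) := by
  induction k with
  | zero => simp; ring_nf; rfl
  | succ k ih =>
    have hk : (0 : ℝ) < k + (a - 1 / 2) + 1 := by
      have : (0 : ℝ) ≤ k := k.cast_nonneg
      linarith
    rw [show ((k + 1 : ℕ) : ℝ) + (a - 1 / 2) + 1 = (k + (a - 1 / 2) + 1) + 1 by push_cast; ring,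
      Real.Gamma_add_one hk.ne', show 2 * (k + 1) = (2 * k + 1) + 1 by ring, Nat.factorial_succ,
      Nat.factorial_succ, Nat.factorial_succ]
    push_cast
    calc _ = (2 * (k : ℝ) + 1 + 1) * (2 * k + 1) *
          ((2 * k).factorial * Real.Gamma (a + 1 / 2)) := by ring
      _ ≤ (2 * (k : ℝ) + 1 + 1) * (2 * (k + (a - 1 / 2) + 1)) *
          (4 ^ k * (k.factorial * Real.Gamma (k + (a - 1 / 2) + 1))) := by
        have := Real.Gamma_pos_of_pos (show 0 < a + 1 / 2 by linarith)
        gcongr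
        linarith
      _ = _ := by ring

lemma rpow_mul_besselI_nonneg {a z : ℝ} (ha : 0 ≤ a) (hz : 0 < z) :
    0 ≤ z ^ (-a + 1 / 2) * besselI (a - 1 / 2) z := by
  refine mul_nonneg (by positivity) (tsum_nonneg fun k => ?_)
  have : (0 : ℝ) < k + (a - 1 / 2) + 1 := by
    have : (0 : ℝ) ≤ k := k.cast_nonneg
    linarith
  have := Real.Gamma_pos_of_pos this
  positivity

lemma rpow_mul_besselI_le {a z : ℝ} (ha : 0 ≤ a) (hz : 0 < z) :
    z ^ (-a + 1 / 2) * besselI (a - 1 / 2) z ≤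
      2 ^ (-a + 1 / 2) / Real.Gamma (a + 1 / 2) * Real.exp z := by
  have hG : 0 < Real.Gamma (a + 1 / 2) := Real.Gamma_pos_of_pos (by linarith)
  have hterm (k : ℕ) : z ^ (-a + 1 / 2) * (1 / ((k.factorial : ℝ) *
      Real.Gamma ((k : ℝ) + (a - 1 / 2) + 1)) * (z / 2) ^ (2 * (k : ℝ) + (a - 1 / 2))) ≤
      2 ^ (-a + 1 / 2) / Real.Gamma (a + 1 / 2) * (z ^ (2 * k) / (2 * k).factorial) := by
    have hk : (0 : ℝ) < k + (a - 1 / 2) + 1 := by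
      have : (0 : ℝ) ≤ k := k.cast_nonneg
      linarith
    have hGk := Real.Gamma_pos_of_pos hk
    have hpow : z ^ (-a + 1 / 2) * (z / 2) ^ (2 * (k : ℝ) + (a - 1 / 2)) =
        2 ^ (-a + 1 / 2) * z ^ (2 * k) / 4 ^ k := by
      have h4 : (4 : ℝ) ^ k = 2 ^ (2 * (k : ℝ)) := by
        rw [Real.rpow_mul two_pos.le, Real.rpow_natCast]; norm_num
      have hzk : z ^ (2 * k) = z ^ (2 * (k : ℝ)) := by
        rw [← Real.rpow_natCast]; push_cast; rfl
      rw [Real.div_rpow hz.le two_pos.le, h4, hzk, mul_div_assoc', ← Real.rpow_add hz,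
        div_eq_div_iff (by positivity) (by positivity), mul_right_comm, ← Real.rpow_add two_pos,
        mul_comm]
      ring_nf
    calc _ = 2 ^ (-a + 1 / 2) * z ^ (2 * k) /
          (4 ^ k * (k.factorial * Real.Gamma (k + (a - 1 / 2) + 1))) := by
          rw [mul_left_comm, hpow]; field_simp
      _ ≤ 2 ^ (-a + 1 / 2) * z ^ (2 * k) /
          ((2 * k).factorial * Real.Gamma (a + 1 / 2)) := by
          exact div_le_div_of_nonneg_left (by positivity) (by positivity)
            (factorial_two_mul_mul_Gamma_le ha k)
      _ = _ := by field_simp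
  have hnn (k : ℕ) : 0 ≤ z ^ (-a + 1 / 2) * (1 / ((k.factorial : ℝ) *
      Real.Gamma ((k : ℝ) + (a - 1 / 2) + 1)) * (z / 2) ^ (2 * (k : ℝ) + (a - 1 / 2))) := by
    have : (0 : ℝ) < k + (a - 1 / 2) + 1 := by
      have : (0 : ℝ) ≤ k := k.cast_nonneg
      linarith
    have := Real.Gamma_pos_of_pos this
    positivity
  have hsum := (Real.hasSum_cosh z).mul_left (2 ^ (-a + 1 / 2) / Real.Gamma (a + 1 / 2))
  calc z ^ (-a + 1 / 2) * besselI (a - 1 / 2) z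
      ≤ 2 ^ (-a + 1 / 2) / Real.Gamma (a + 1 / 2) * Real.cosh z := by
        rw [besselI, ← tsum_mul_left, ← hsum.tsum_eq]
        exact (Summable.of_nonneg_of_le hnn hterm hsum.summable).tsum_le_tsum hterm hsum.summable
    _ ≤ _ := by
        gcongr
        rw [Real.cosh_eq]
        have := Real.exp_le_exp.mpr (show -z ≤ z by linarith)
        linarith

lemma measurable_eNorm (d : ℕ) : Measurable (eNorm d) := by
  unfold eNorm
  fun_prop

lemma measurable_uncurry_heatK (d : ℕ) (α x : Fin d → ℝ) :
    Measurable fun p : ℝ × (Fin d → ℝ) => heatK d α p.1 x p.2 := by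
  have := measurable_eNorm d
  have := fun j => measurable_besselI (α j - 1 / 2)
  unfold heatK
  fun_prop

lemma heatK_nonneg {d : ℕ} {α x y : Fin d → ℝ} (hα : ∀ j, 0 ≤ α j) (hx : x ∈ posOrth d)
    (hy : y ∈ posOrth d) {u : ℝ} (hu : 0 < u) : 0 ≤ heatK d α u x y := by
  refine mul_nonneg (by positivity) (Finset.prod_nonneg fun j _ => ?_)
  have := hx j
  have := hy j
  exact rpow_mul_besselI_nonneg (hα j) (by positivity)

lemma heatK_le {d : ℕ} {α x y : Fin d → ℝ} (hα : ∀ j, 0 ≤ α j) (hx : x ∈ posOrth d)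
    (hy : y ∈ posOrth d) {u : ℝ} (hu : 0 < u) :
    heatK d α u x y ≤ (2 * u) ^ (-(∑ j, α j) - (d : ℝ) / 2) *
      ∏ j, 2 ^ (-α j + 1 / 2) / Real.Gamma (α j + 1 / 2) := by
  have hz (j : Fin d) : 0 < x j * y j / (2 * u) := by
    have := hx j
    have := hy j
    positivity
  have hC : 0 ≤ ∏ j, 2 ^ (-α j + 1 / 2) / Real.Gamma (α j + 1 / 2) :=
    Finset.prod_nonneg fun j _ => by
      have := Real.Gamma_pos_of_pos (show 0 < α j + 1 / 2 by have := hα j; linarith)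
      positivity
  have hexp : Real.exp (-((eNorm d x) ^ 2 + (eNorm d y) ^ 2) / (4 * u)) *
      Real.exp (∑ j, x j * y j / (2 * u)) ≤ 1 := by
    rw [← Real.exp_add, Real.exp_le_one_iff, eNorm, eNorm, Real.sq_sqrt (by positivity),
      Real.sq_sqrt (by positivity), ← Finset.sum_add_distrib, ← Finset.sum_neg_distrib,
      Finset.sum_div, ← Finset.sum_add_distrib]
    refine Finset.sum_nonpos fun j _ => ?_
    rw [show -(x j ^ 2 + y j ^ 2) / (4 * u) + x j * y j / (2 * u) =
      -((x j - y j) ^ 2 / (4 * u)) by field_simp; ring]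
    exact neg_nonpos.mpr (by positivity)
  calc heatK d α u x y
      ≤ (2 * u) ^ (-(∑ j, α j) - (d : ℝ) / 2) *
        Real.exp (-((eNorm d x) ^ 2 + (eNorm d y) ^ 2) / (4 * u)) *
        ∏ j, (2 ^ (-α j + 1 / 2) / Real.Gamma (α j + 1 / 2) *
          Real.exp (x j * y j / (2 * u))) := by
        unfold heatK
        refine mul_le_mul_of_nonneg_left ?_ (by positivity)
        exact Finset.prod_le_prod (fun j _ => rpow_mul_besselI_nonneg (hα j) (hz j))
          fun j _ => rpow_mul_besselI_le (hα j) (hz j)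
    _ = (2 * u) ^ (-(∑ j, α j) - (d : ℝ) / 2) *
        (∏ j, 2 ^ (-α j + 1 / 2) / Real.Gamma (α j + 1 / 2)) *
        (Real.exp (-((eNorm d x) ^ 2 + (eNorm d y) ^ 2) / (4 * u)) *
          Real.exp (∑ j, x j * y j / (2 * u))) := by
        rw [Finset.prod_mul_distrib, Real.exp_sum]
        ring
    _ ≤ _ := mul_le_of_le_one_right (by positivity) hexp

lemma isLocallyFiniteMeasure_wMeasure {d : ℕ} {α : Fin d → ℝ} (hα : ∀ j, 0 ≤ α j) :
    IsLocallyFiniteMeasure (wMeasure d α) := by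
  refine IsLocallyFiniteMeasure.withDensity_ofReal (continuous_finsetProd _ fun j _ => ?_)
  exact (continuous_apply j).rpow_const fun _ => Or.inr (by have := hα j; positivity)

lemma ae_mem_posOrth (d : ℕ) (α : Fin d → ℝ) : ∀ᵐ y ∂wMeasure d α, y ∈ posOrth d := by
  refine (withDensity_absolutelyContinuous _ _).ae_le (ae_restrict_mem ?_)
  have : posOrth d = ⋂ j, {y : Fin d → ℝ | 0 < y j} := by ext; simp [posOrth]
  rw [this]
  exact MeasurableSet.iInter fun j => measurableSet_lt measurable_const (measurable_pi_apply j)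

/-- Fubini: the Poisson operator is subordinated to the heat operator. -/
lemma poissonOp_eq {d : ℕ} {α x : Fin d → ℝ} (hα : ∀ j, 0 ≤ α j) (hx : x ∈ posOrth d)
    {f : (Fin d → ℝ) → ℝ} (hf : Integrable f (wMeasure d α)) {t : ℝ} (ht : 0 < t) :
    poissonOp d α t f x = (1 / Real.sqrt (2 * Real.pi)) * (t * ∫ u in Ioi (0 : ℝ),
      u ^ (-(3 : ℝ) / 2) * Real.exp (-(t ^ 2) / (4 * u)) *
        ∫ y, heatK d α u x y * f y ∂(wMeasure d α)) := by
  have := isLocallyFiniteMeasure_wMeasure hα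
  have hβ : 0 ≤ ∑ j, α j := Finset.sum_nonneg fun j _ => hα j
  set C := ∏ j, 2 ^ (-α j + 1 / 2) / Real.Gamma (α j + 1 / 2)
  have hprod : Integrable (Function.uncurry fun (u : ℝ) (y : Fin d → ℝ) =>
      u ^ (-(3 : ℝ) / 2) * Real.exp (-(t ^ 2) / (4 * u)) * (heatK d α u x y * f y))
      ((volume.restrict (Ioi (0 : ℝ))).prod (wMeasure d α)) := by
    have hk := ((integrableOn_rpow_neg_mul_exp_neg_div
      (s := 3 / 2 + ((∑ j, α j) + (d : ℝ) / 2)) (b := t ^ 2 / 4)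
      (by have : (0 : ℝ) ≤ d := d.cast_nonneg
          linarith) (by positivity)).const_mul
        (2 ^ (-(∑ j, α j) - (d : ℝ) / 2) * C)).mul_prod hf.norm
    refine hk.mono' ?_ ?_
    · have h1 := measurable_uncurry_heatK d α x
      have h2 : AEStronglyMeasurable (fun p : ℝ × (Fin d → ℝ) => f p.2)
        ((volume.restrict (Ioi (0 : ℝ))).prod (wMeasure d α)) := hf.1.comp_snd
      refine AEStronglyMeasurable.mul ?_ (h1.aestronglyMeasurable.mul h2)
      exact Measurable.aestronglyMeasurable (by fun_prop)
    · filter_upwards [Measure.quasiMeasurePreserving_fst.ae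
        (ae_restrict_mem (measurableSet_Ioi (a := (0 : ℝ)))),
        Measure.quasiMeasurePreserving_snd.ae (ae_mem_posOrth d α)] with p hp1 hp2
      have hp1 : 0 < p.1 := hp1
      have h0 := heatK_nonneg hα hx hp2 hp1
      have h1 := heatK_le hα hx hp2 hp1
      simp only [Function.uncurry, norm_mul]
      rw [Real.norm_of_nonneg h0, Real.norm_of_nonneg (by positivity),
        Real.norm_of_nonneg (Real.exp_pos _).le, ← mul_assoc]
      refine mul_le_mul_of_nonneg_right ?_ (norm_nonneg _)
      calc _ ≤ p.1 ^ (-(3 : ℝ) / 2) * Real.exp (-(t ^ 2) / (4 * p.1)) *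
            ((2 * p.1) ^ (-(∑ j, α j) - (d : ℝ) / 2) * C) := by gcongr
        _ = _ := by
          rw [Real.mul_rpow two_pos.le hp1.le,
            show -(3 / 2 + ((∑ j, α j) + (d : ℝ) / 2)) =
              -(3 : ℝ) / 2 + (-(∑ j, α j) - (d : ℝ) / 2) by ring, Real.rpow_add hp1,
            show -(t ^ 2) / (4 * p.1) = -(t ^ 2 / 4 / p.1) by field_simp]
          ring
  have hswap := integral_integral_swap hprod
  simp_rw [integral_const_mul] at hswap
  rw [hswap, poissonOp, ← integral_const_mul, ← integral_const_mul]
  refine integral_congr_ae (Eventually.of_forall fun y => ?_)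
  simp only [← mul_assoc, integral_mul_const, poissonK]
  ring

lemma aestronglyMeasurable_integral_heatK {d : ℕ} {α : Fin d → ℝ} (x : Fin d → ℝ)
    (hα : ∀ j, 0 ≤ α j) {f : (Fin d → ℝ) → ℝ} (hf : Integrable f (wMeasure d α)) :
    AEStronglyMeasurable (fun u => ∫ y, heatK d α u x y * f y ∂(wMeasure d α))
      (volume.restrict (Ioi (0 : ℝ))) := by
  have := isLocallyFiniteMeasure_wMeasure hα
  have h : AEStronglyMeasurable (fun p : ℝ × (Fin d → ℝ) => heatK d α p.1 x p.2 * f p.2)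
      ((volume.restrict (Ioi (0 : ℝ))).prod (wMeasure d α)) :=
    (measurable_uncurry_heatK d α x).aestronglyMeasurable.mul hf.1.comp_snd
  exact AEStronglyMeasurable.integral_prod_right' h

lemma exists_abs_integral_heatK_le {d : ℕ} {α x : Fin d → ℝ} (hα : ∀ j, 0 ≤ α j)
    (hx : x ∈ posOrth d) {f : (Fin d → ℝ) → ℝ} (hf : Integrable f (wMeasure d α)) :
    ∃ C, ∀ u, 0 < u → |∫ y, heatK d α u x y * f y ∂(wMeasure d α)| ≤
      C * u ^ (-(∑ j, α j + (d : ℝ) / 2)) := by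
  refine ⟨2 ^ (-(∑ j, α j) - (d : ℝ) / 2) *
    (∏ j, 2 ^ (-α j + 1 / 2) / Real.Gamma (α j + 1 / 2)) * ∫ y, |f y| ∂(wMeasure d α),
    fun u hu => ?_⟩
  rw [← Real.norm_eq_abs]
  calc ‖∫ y, heatK d α u x y * f y ∂(wMeasure d α)‖
      ≤ ∫ y, (2 * u) ^ (-(∑ j, α j) - (d : ℝ) / 2) *
        (∏ j, 2 ^ (-α j + 1 / 2) / Real.Gamma (α j + 1 / 2)) * |f y| ∂(wMeasure d α) := by
        refine norm_integral_le_of_norm_le (hf.abs.const_mul _) ?_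
        filter_upwards [ae_mem_posOrth d α] with y hy
        rw [Real.norm_eq_abs, abs_mul, abs_of_nonneg (heatK_nonneg hα hx hy hu)]
        exact mul_le_mul_of_nonneg_right (heatK_le hα hx hy hu) (abs_nonneg _)
    _ = _ := by
      rw [integral_const_mul, Real.mul_rpow two_pos.le hu.le, neg_add']
      ring

lemma abs_subordination_integrand_le {F : ℝ → ℝ} {C β γ t u : ℝ}
    (hF : |F u| ≤ C * u ^ (-β)) (hu : 0 < u) :
    |u ^ γ * Real.exp (-(t ^ 2) / (4 * u)) * F u| ≤
      C * (u ^ (-(β - γ)) * Real.exp (-(t ^ 2 / 4 / u))) := by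
  rw [abs_mul, abs_of_pos (by positivity : 0 < u ^ γ * Real.exp (-(t ^ 2) / (4 * u)))]
  calc _ ≤ u ^ γ * Real.exp (-(t ^ 2) / (4 * u)) * (C * u ^ (-β)) := by gcongr
    _ = _ := by
      rw [show -(β - γ) = γ + -β by ring, Real.rpow_add hu,
        show -(t ^ 2) / (4 * u) = -(t ^ 2 / 4 / u) by field_simp]
      ring

lemma aestronglyMeasurable_subordination_integrand {F : ℝ → ℝ}
    (hFm : AEStronglyMeasurable F (volume.restrict (Ioi (0 : ℝ)))) (γ t : ℝ) :
    AEStronglyMeasurable (fun u => u ^ γ * Real.exp (-(t ^ 2) / (4 * u)) * F u)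
      (volume.restrict (Ioi (0 : ℝ))) :=
  AEStronglyMeasurable.mul (Measurable.aestronglyMeasurable (by fun_prop)) hFm

/-- Differentiation under the integral sign in a subordination integral whose integrand has
power growth. -/
lemma hasDerivAt_subordination {F : ℝ → ℝ} {C β t : ℝ} (hβ : 0 ≤ β)
    (hFm : AEStronglyMeasurable F (volume.restrict (Ioi (0 : ℝ))))
    (hF : ∀ u, 0 < u → |F u| ≤ C * u ^ (-β)) (ht : 0 < t) :
    HasDerivAt (fun s => ∫ u in Ioi (0 : ℝ),
        u ^ (-(3 : ℝ) / 2) * Real.exp (-(s ^ 2) / (4 * u)) * F u)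
      (∫ u in Ioi (0 : ℝ), -(t / 2) *
        (u ^ (-(5 : ℝ) / 2) * Real.exp (-(t ^ 2) / (4 * u)) * F u)) t := by
  have hC : 0 ≤ C := by simpa using (abs_nonneg _).trans (hF 1 one_pos)
  refine (hasDerivAt_integral_of_dominated_loc_of_deriv_le
    (F' := fun s u => -(s / 2) *
      (u ^ (-(5 : ℝ) / 2) * Real.exp (-(s ^ 2) / (4 * u)) * F u))
    (bound := fun u => t * (C * (u ^ (-(β - -(5 : ℝ) / 2)) *
      Real.exp (-((t / 2) ^ 2 / 4 / u)))))
    (Ioo_mem_nhds (show t / 2 < t by linarith) (show t < 2 * t by linarith))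
    (Eventually.of_forall fun s => aestronglyMeasurable_subordination_integrand hFm _ s) ?_
    ((aestronglyMeasurable_subordination_integrand hFm _ t).const_mul _) ?_ ?_ ?_).2
  · refine ((integrableOn_rpow_neg_mul_exp_neg_div (s := β - -(3 : ℝ) / 2) (b := t ^ 2 / 4)
      (by linarith) (by positivity)).const_mul C).mono'
      (aestronglyMeasurable_subordination_integrand hFm _ t) ?_
    filter_upwards [ae_restrict_mem measurableSet_Ioi] with u hu
    exact abs_subordination_integrand_le (hF u hu) hu
  · filter_upwards [ae_restrict_mem measurableSet_Ioi] with u hu s hs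
    have hu : 0 < u := hu
    have hs0 : 0 < s := by linarith [hs.1]
    rw [norm_mul, norm_neg, Real.norm_of_nonneg (by positivity : 0 ≤ s / 2)]
    refine mul_le_mul (by linarith [hs.2]) ?_ (norm_nonneg _) ht.le
    refine (abs_subordination_integrand_le (hF u hu) hu).trans ?_
    have := hs.1.le
    gcongr
  · exact ((integrableOn_rpow_neg_mul_exp_neg_div (by linarith) (by positivity)).const_mul
      C).const_mul t
  · filter_upwards [ae_restrict_mem measurableSet_Ioi] with u hu s hs
    have hu : 0 < u := hu
    have hexp : HasDerivAt (fun s : ℝ => Real.exp (-(s ^ 2) / (4 * u)))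
        (Real.exp (-(s ^ 2) / (4 * u)) * (-(2 * s) / (4 * u))) s := by
      simpa using ((hasDerivAt_pow 2 s).fun_neg.div_const (4 * u)).exp
    refine ((hexp.const_mul (u ^ (-(3 : ℝ) / 2))).mul_const (F u)).congr_deriv ?_
    have : u ^ (-(3 : ℝ) / 2) = u ^ (-(5 : ℝ) / 2) * u := by
      rw [← Real.rpow_add_one hu.ne']
      norm_num
    rw [this]
    field_simp
    ring

lemma abs_integral_subordination_le {F : ℝ → ℝ} {C β γ t : ℝ} (hβ : 0 ≤ β) (hγ : γ < -1)
    (hF : ∀ u, 0 < u → |F u| ≤ C * u ^ (-β)) (ht : 0 < t) :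
    |∫ u in Ioi (0 : ℝ), u ^ γ * Real.exp (-(t ^ 2) / (4 * u)) * F u| ≤
      C * 4 ^ (β - γ - 1) * Real.Gamma (β - γ - 1) * t ^ (-(2 * (β - γ - 1))) := by
  have hs : 1 < β - γ := by linarith
  rw [← Real.norm_eq_abs]
  calc _ ≤ ∫ u in Ioi (0 : ℝ), C * (u ^ (-(β - γ)) * Real.exp (-(t ^ 2 / 4 / u))) := by
        refine norm_integral_le_of_norm_le
          ((integrableOn_rpow_neg_mul_exp_neg_div (b := t ^ 2 / 4) hs
            (by positivity)).const_mul C) ?_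
        filter_upwards [ae_restrict_mem measurableSet_Ioi] with u hu
        exact abs_subordination_integrand_le (hF u hu) hu
    _ = _ := by
      rw [integral_const_mul, integral_rpow_neg_mul_exp_neg_div hs (by positivity), one_div_div,
        Real.div_rpow (by norm_num) (by positivity), Real.rpow_neg ht.le,
        Real.rpow_mul ht.le, Real.rpow_two, div_eq_mul_inv]
      ring

lemma tendsto_mul_deriv_subordination {F : ℝ → ℝ} {C β : ℝ} (hβ : 0 < β)
    (hFm : AEStronglyMeasurable F (volume.restrict (Ioi (0 : ℝ))))
    (hF : ∀ u, 0 < u → |F u| ≤ C * u ^ (-β)) :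
    Tendsto (fun t => t * deriv (fun s => s * ∫ u in Ioi (0 : ℝ),
        u ^ (-(3 : ℝ) / 2) * Real.exp (-(s ^ 2) / (4 * u)) * F u) t) atTop (nhds 0) := by
  set A := C * 4 ^ (β - -(3 : ℝ) / 2 - 1) * Real.Gamma (β - -(3 : ℝ) / 2 - 1)
  set B := C * 4 ^ (β - -(5 : ℝ) / 2 - 1) * Real.Gamma (β - -(5 : ℝ) / 2 - 1)
  have hlim : Tendsto (fun t : ℝ => (A + B / 2) * t ^ (-(2 * β))) atTop (nhds 0) := by
    simpa using (tendsto_rpow_neg_atTop (show 0 < 2 * β by positivity)).const_mul (A + B / 2)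
  refine squeeze_zero_norm' ?_ hlim
  filter_upwards [eventually_gt_atTop 0] with t ht
  have hA := abs_integral_subordination_le (γ := -(3 : ℝ) / 2) hβ.le (by norm_num) hF ht
  have hB := abs_integral_subordination_le (γ := -(5 : ℝ) / 2) hβ.le (by norm_num) hF ht
  rw [((hasDerivAt_id' t).fun_mul (hasDerivAt_subordination hβ.le hFm hF ht)).deriv,
    integral_const_mul]
  set I := ∫ u in Ioi (0 : ℝ), u ^ (-(3 : ℝ) / 2) * Real.exp (-(t ^ 2) / (4 * u)) * F u
  set J := ∫ u in Ioi (0 : ℝ), u ^ (-(5 : ℝ) / 2) * Real.exp (-(t ^ 2) / (4 * u)) * F u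
  have h3 : t ^ (-(2 * (β - -(3 : ℝ) / 2 - 1))) * t = t ^ (-(2 * β)) := by
    rw [← Real.rpow_add_one ht.ne']
    ring_nf
  have h5 : t ^ (-(2 * (β - -(5 : ℝ) / 2 - 1))) * t ^ 3 = t ^ (-(2 * β)) := by
    rw [← Real.rpow_natCast t 3, ← Real.rpow_add ht]
    push_cast
    ring_nf
  calc ‖t * (1 * I + t * (-(t / 2) * J))‖ = |t * I + -(t ^ 3 / 2 * J)| := by
        rw [Real.norm_eq_abs]
        ring_nf
    _ ≤ |t * I| + |-(t ^ 3 / 2 * J)| := abs_add_le _ _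
    _ = t * |I| + t ^ 3 / 2 * |J| := by
      rw [abs_neg, abs_mul, abs_mul, abs_of_pos ht, abs_of_pos (by positivity : 0 < t ^ 3 / 2)]
    _ ≤ t * (A * t ^ (-(2 * (β - -(3 : ℝ) / 2 - 1)))) +
        t ^ 3 / 2 * (B * t ^ (-(2 * (β - -(5 : ℝ) / 2 - 1)))) := by gcongr
    _ = _ := by linear_combination A * h3 + B / 2 * h5

lemma mul_integral_rpow_mul_exp_eq {t : ℝ} (ht : 0 < t) :
    t * ∫ u in Ioi (0 : ℝ), u ^ (-(3 : ℝ) / 2) * Real.exp (-(t ^ 2) / (4 * u)) =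
      2 * Real.Gamma (1 / 2) := by
  have h := integral_rpow_neg_mul_exp_neg_div (s := 3 / 2) (b := t ^ 2 / 4) (by norm_num)
    (by positivity)
  have hsqrt : (1 / (t ^ 2 / 4)) ^ ((3 : ℝ) / 2 - 1) = 2 / t := by
    rw [show 1 / (t ^ 2 / 4) = (2 / t) ^ (2 : ℝ) by rw [Real.rpow_two]; field_simp; norm_num,
      ← Real.rpow_mul (by positivity)]
    norm_num
  have hrw (u : ℝ) : -(t ^ 2) / (4 * u) = -(t ^ 2 / 4 / u) := by
    rw [neg_div, div_div]
  simp_rw [hrw, neg_div]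
  rw [h, hsqrt, show (3 : ℝ) / 2 - 1 = 1 / 2 by norm_num]
  field_simp

/-- `t ∂_t P_t^α f(x) → 0` as `t → +∞`. -/
theorem poisson_t_deriv_tendsto_zero_atTop (d : ℕ) (α : Fin d → ℝ)
    (hα : ∀ j, 0 ≤ α j) (f : (Fin d → ℝ) → ℝ) (hf : CcInfPos d f)
    (x : Fin d → ℝ) (hx : x ∈ posOrth d) :
    Tendsto (fun t => t * deriv (fun s => poissonOp d α s f x) t)
      atTop (nhds 0) := by
  have := isLocallyFiniteMeasure_wMeasure hα
  have hfi : Integrable f (wMeasure d α) :=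
    hf.1.continuous.integrable_of_hasCompactSupport hf.2.1
  set F : ℝ → ℝ := fun u => ∫ y, heatK d α u x y * f y ∂(wMeasure d α) with hF
  have hderiv : ∀ᶠ t : ℝ in atTop, deriv (fun s => poissonOp d α s f x) t =
      (1 / Real.sqrt (2 * Real.pi)) * deriv (fun s => s * ∫ u in Ioi (0 : ℝ),
        u ^ (-(3 : ℝ) / 2) * Real.exp (-(s ^ 2) / (4 * u)) * F u) t := by
    filter_upwards [eventually_gt_atTop 0] with t ht
    rw [← deriv_const_mul_field]
    refine Filter.EventuallyEq.deriv_eq ?_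
    filter_upwards [eventually_gt_nhds ht] with s hs
    exact poissonOp_eq hα hx hfi hs
  suffices h : Tendsto (fun t => t * deriv (fun s => s * ∫ u in Ioi (0 : ℝ),
      u ^ (-(3 : ℝ) / 2) * Real.exp (-(s ^ 2) / (4 * u)) * F u) t) atTop (nhds 0) by
    have h' := h.const_mul (1 / Real.sqrt (2 * Real.pi))
    rw [mul_zero] at h'
    refine h'.congr' ?_
    filter_upwards [hderiv] with t ht
    rw [ht]
    ring
  rcases Nat.eq_zero_or_pos d with rfl | hd
  · have hconst : F = fun _ => ∫ y, f y ∂(wMeasure 0 α) := by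
      funext u
      simp [hF, heatK, eNorm]
    refine tendsto_const_nhds.congr' ?_
    filter_upwards [eventually_gt_atTop 0] with t ht
    have : (fun s => s * ∫ u in Ioi (0 : ℝ),
        u ^ (-(3 : ℝ) / 2) * Real.exp (-(s ^ 2) / (4 * u)) * F u) =ᶠ[nhds t]
        fun _ => 2 * Real.Gamma (1 / 2) * ∫ y, f y ∂(wMeasure 0 α) := by
      filter_upwards [eventually_gt_nhds ht] with s hs
      simp only [hconst]
      rw [integral_mul_const, ← mul_assoc, mul_integral_rpow_mul_exp_eq hs]
    rw [this.deriv_eq, deriv_const, mul_zero]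
  · obtain ⟨C, hC⟩ := exists_abs_integral_heatK_le hα hx hfi
    refine tendsto_mul_deriv_subordination ?_ (aestronglyMeasurable_integral_heatK x hα hfi) hC
    have : 0 ≤ ∑ j, α j := Finset.sum_nonneg fun j _ => hα j
    have : (0 : ℝ) < d := by exact_mod_cast hd
    positivity
end
end

section
/- Let α ∈ [0,∞)^d. There exists a constant C > 0, depending only on α and d, such that for every i = 1,…,d, every x, y ∈ ℝ_+^d and every t > 0, |∂_{x_i} 𝒫_t^α(x,y)| ≤ C t (x_i + y_i) / (t² + |x−y|²)^{|α| + (d+3)/2}. -/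
open MeasureTheory Real Filter Set
open scoped ENNReal BigOperators

noncomputable section

lemma hasSum_natCast_mul_pow_div_factorial_sinh (r : ℝ) :
    HasSum (fun k : ℕ => ((2 * k : ℕ) : ℝ) * r ^ (2 * k - 1) / ((2 * k).factorial : ℝ))
      (Real.sinh r) := by
  have h := (hasSum_nat_add_iff
    (f := fun k : ℕ => ((2 * k : ℕ) : ℝ) * r ^ (2 * k - 1) / ((2 * k).factorial : ℝ))
    (g := Real.sinh r) 1).1 ?_
  · simpa using h
  · refine (Real.hasSum_sinh r).congr_fun fun k => ?_
    have e : 2 * (k + 1) = (2 * k + 1) + 1 := by ring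
    rw [e, Nat.factorial_succ, Nat.add_sub_cancel, Nat.cast_mul]
    have h1 : (((2 * k + 1 + 1 : ℕ)) : ℝ) ≠ 0 := by positivity
    have h2 : (((2 * k + 1).factorial : ℕ) : ℝ) ≠ 0 := by positivity
    field_simp

/-- An even power series whose coefficients are dominated by those of `cosh` is differentiable,
and it and its derivative grow at most like `exp`. -/
lemma even_powerSeries_bounds {b : ℕ → ℝ} {M : ℝ} (hM : 0 ≤ M)
    (hb : ∀ k, |b k| ≤ M / ((2 * k).factorial : ℝ)) :
    Differentiable ℝ (fun z : ℝ => ∑' k : ℕ, b k * z ^ (2 * k)) ∧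
      ∀ z : ℝ, 0 ≤ z →
        |∑' k : ℕ, b k * z ^ (2 * k)| ≤ M * Real.exp z ∧
        |deriv (fun z : ℝ => ∑' k : ℕ, b k * z ^ (2 * k)) z| ≤ M * Real.exp z := by
  have hD : ∀ k : ℕ, ∀ r z : ℝ, |z| ≤ r →
      ‖b k * (((2 * k : ℕ) : ℝ) * z ^ (2 * k - 1))‖ ≤
        M * (((2 * k : ℕ) : ℝ) * r ^ (2 * k - 1) / ((2 * k).factorial : ℝ)) := by
    intro k r z hz
    rw [norm_mul, norm_mul, norm_pow, Real.norm_eq_abs, Real.norm_eq_abs, Real.norm_eq_abs,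
      abs_of_nonneg (Nat.cast_nonneg (α := ℝ) (2 * k))]
    calc |b k| * (((2 * k : ℕ) : ℝ) * |z| ^ (2 * k - 1))
        ≤ M / ((2 * k).factorial : ℝ) * (((2 * k : ℕ) : ℝ) * r ^ (2 * k - 1)) := by
          gcongr
          exact hb k
      _ = _ := by ring
  have hderiv : ∀ z : ℝ, HasDerivAt (fun z : ℝ => ∑' k : ℕ, b k * z ^ (2 * k))
      (∑' k : ℕ, b k * (((2 * k : ℕ) : ℝ) * z ^ (2 * k - 1))) z := by
    intro z
    refine hasDerivAt_tsum_of_isPreconnected (t := Metric.ball (0 : ℝ) (|z| + 1)) (y₀ := 0)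
      ((hasSum_natCast_mul_pow_div_factorial_sinh (|z| + 1)).summable.mul_left M)
      Metric.isOpen_ball (convex_ball _ _).isPreconnected
      (fun k w _ => (hasDerivAt_pow (2 * k) w).const_mul (b k)) (fun k w hw => hD k _ w ?_) ?_ ?_ ?_
    · exact (Real.norm_eq_abs w).symm.le.trans (mem_ball_zero_iff.1 hw).le
    · simp; positivity
    · refine summable_of_ne_finset_zero (s := {0}) fun k hk => ?_
      simp_all
    · simp
  refine ⟨fun z => (hderiv z).differentiableAt, fun z hz => ⟨?_, ?_⟩⟩
  · have h : |∑' k : ℕ, b k * z ^ (2 * k)| ≤ M * Real.cosh z := by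
      rw [← Real.norm_eq_abs]
      refine tsum_of_norm_bounded ((Real.hasSum_cosh z).mul_left M) fun k => ?_
      rw [norm_mul, Real.norm_eq_abs, Real.norm_of_nonneg (by positivity)]
      calc |b k| * z ^ (2 * k) ≤ M / ((2 * k).factorial : ℝ) * z ^ (2 * k) := by
            gcongr
            exact hb k
        _ = _ := by ring
    refine h.trans (mul_le_mul_of_nonneg_left ?_ hM)
    rw [Real.cosh_eq]
    linarith [Real.exp_le_exp.2 (by linarith : -z ≤ z)]
  · rw [(hderiv z).deriv]
    have h := tsum_of_norm_bounded ((hasSum_natCast_mul_pow_div_factorial_sinh z).mul_left M)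
      fun k => hD k z z (abs_of_nonneg hz).le
    rw [Real.norm_eq_abs] at h
    refine h.trans (mul_le_mul_of_nonneg_left ?_ hM)
    rw [Real.sinh_eq]
    linarith [Real.exp_pos z, Real.exp_pos (-z)]

lemma factorial_two_mul_le_Gamma {μ : ℝ} (hμ : -(1 / 2) ≤ μ) (k : ℕ) :
    ((2 * k).factorial : ℝ) ≤
      (1 / Real.Gamma (μ + 1)) * (4 ^ k * ((k.factorial : ℝ) * Real.Gamma ((k : ℝ) + μ + 1))) := by
  have hG : 0 < Real.Gamma (μ + 1) := Real.Gamma_pos_of_pos (by linarith)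
  induction k with
  | zero => simp [hG.ne']
  | succ k ih =>
    have hk : (0 : ℝ) ≤ k := Nat.cast_nonneg k
    have e : 2 * (k + 1) = (2 * k + 1) + 1 := by ring
    have e2 : ((k + 1 : ℕ) : ℝ) + μ + 1 = ((k : ℝ) + μ + 1) + 1 := by push_cast; ring
    rw [e, Nat.factorial_succ, Nat.factorial_succ, Nat.factorial_succ, e2,
      Real.Gamma_add_one (s := (k : ℝ) + μ + 1) (by linarith)]
    push_cast
    calc (2 * (k : ℝ) + 1 + 1) * ((2 * k + 1) * ((2 * k).factorial : ℝ))
        = (2 * (k + 1) * (2 * (k : ℝ) + 1)) * ((2 * k).factorial : ℝ) := by ring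
      _ ≤ (2 * (k + 1) * (2 * ((k : ℝ) + μ + 1))) *
          ((1 / Real.Gamma (μ + 1)) *
            (4 ^ k * ((k.factorial : ℝ) * Real.Gamma ((k : ℝ) + μ + 1)))) := by
          have : 2 * (k : ℝ) + 1 ≤ 2 * ((k : ℝ) + μ + 1) := by linarith
          have : (0 : ℝ) ≤ k + μ + 1 := by linarith
          gcongr
      _ = _ := by ring

/-- The function `z ^ (-μ) * I_μ z` extends to an entire function of exponential type one. -/
lemma exists_entire_besselI {a : ℝ} (ha : 0 ≤ a) :
    ∃ (C : ℝ) (E : ℝ → ℝ), 0 < C ∧ Differentiable ℝ E ∧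
      (∀ z, 0 < z → z ^ (-a + 1 / 2) * besselI (a - 1 / 2) z = E z) ∧
      ∀ z, 0 ≤ z → |E z| ≤ C * Real.exp z ∧ |deriv E z| ≤ C * Real.exp z := by
  obtain ⟨μ, rfl⟩ : ∃ μ, a = μ + 1 / 2 := ⟨a - 1 / 2, by ring⟩
  have hμ : -(1 / 2) ≤ μ := by linarith
  have hG : ∀ k : ℕ, 0 < Real.Gamma ((k : ℝ) + μ + 1) := fun k =>
    Real.Gamma_pos_of_pos (by linarith [Nat.cast_nonneg (α := ℝ) k])
  have hG0 : 0 < Real.Gamma (μ + 1) := Real.Gamma_pos_of_pos (by linarith)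
  set b : ℕ → ℝ := fun k =>
    (2 : ℝ) ^ (-μ) * (1 / (4 ^ k * ((k.factorial : ℝ) * Real.Gamma ((k : ℝ) + μ + 1)))) with hb
  have hM : 0 < (2 : ℝ) ^ (-μ) * (1 / Real.Gamma (μ + 1)) := by positivity
  have hbb : ∀ k, |b k| ≤ (2 : ℝ) ^ (-μ) * (1 / Real.Gamma (μ + 1)) / ((2 * k).factorial : ℝ) := by
    intro k
    have hp : 0 < 4 ^ k * ((k.factorial : ℝ) * Real.Gamma ((k : ℝ) + μ + 1)) := by
      have := hG k
      positivity
    rw [abs_of_nonneg (by positivity), hb, mul_div_assoc]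
    refine mul_le_mul_of_nonneg_left ?_ (by positivity)
    rw [div_le_div_iff₀ hp (by positivity), one_mul]
    exact factorial_two_mul_le_Gamma hμ k
  obtain ⟨h1, h2⟩ := even_powerSeries_bounds hM.le hbb
  refine ⟨_, _, hM, h1, fun z hz => ?_, h2⟩
  rw [besselI, ← tsum_mul_left]
  refine tsum_congr fun k => ?_
  have e1 : -(μ + 1 / 2) + 1 / 2 = -μ := by ring
  have e2 : μ + 1 / 2 - 1 / 2 = μ := by ring
  have e3 : (z / 2) ^ (2 * (k : ℝ) + μ) = z ^ (2 * k) / 4 ^ k * (z ^ μ * 2 ^ (-μ)) := by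
    rw [Real.rpow_add (by positivity), Real.div_rpow hz.le (by norm_num) μ,
      Real.rpow_neg (by norm_num : (0 : ℝ) ≤ 2), ← div_eq_mul_inv]
    congr 1
    have : (2 * (k : ℝ)) = ((2 * k : ℕ) : ℝ) := by push_cast; ring
    rw [this, Real.rpow_natCast, div_pow, pow_mul (2 : ℝ)]
    norm_num
  have e4 : z ^ (-μ) * z ^ μ = 1 := by rw [← Real.rpow_add hz]; simp
  rw [e1, e2, e3]
  calc _ = (z ^ (-μ) * z ^ μ) * (1 / ((k.factorial : ℝ) * Real.Gamma ((k : ℝ) + μ + 1)) *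
        (z ^ (2 * k) / 4 ^ k * 2 ^ (-μ))) := by ring
    _ = _ := by
      rw [e4, hb]
      have := (hG k).ne'
      field_simp

lemma integral_rpow_mul_exp_neg_div_Ioi {a b : ℝ} (ha : 0 < a) (hb : 0 < b) :
    ∫ u in Set.Ioi (0 : ℝ), u ^ (-a - 1) * Real.exp (-b / u) = b ^ (-a) * Real.Gamma a := by
  have h := MeasureTheory.integral_comp_rpow_Ioi
    (fun u : ℝ => u ^ (a - 1) * Real.exp (-(b * u))) (p := -1) (by norm_num)
  rw [Real.integral_rpow_mul_exp_neg_mul_Ioi ha hb] at h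
  rw [Real.rpow_neg hb.le, ← Real.inv_rpow hb.le, ← one_div, ← h]
  refine setIntegral_congr_fun measurableSet_Ioi fun u hu => ?_
  have hu : 0 < u := hu
  simp only [smul_eq_mul, abs_neg, abs_one, one_mul]
  rw [← Real.rpow_mul hu.le, ← mul_assoc, ← Real.rpow_add hu, Real.rpow_neg_one]
  congr 2
  · ring
  · ring

lemma integrableOn_rpow_mul_exp_neg_div_Ioi {a b : ℝ} (ha : 0 < a) (hb : 0 < b) :
    IntegrableOn (fun u : ℝ => u ^ (-a - 1) * Real.exp (-b / u)) (Set.Ioi (0 : ℝ)) := by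
  refine Integrable.of_integral_ne_zero ?_
  rw [integral_rpow_mul_exp_neg_div_Ioi ha hb]
  have := Real.Gamma_pos_of_pos ha
  positivity

lemma one_dim_exponent (s y u : ℝ) :
    Real.exp (-(s ^ 2 + y ^ 2) / (4 * u)) * Real.exp (s * y / (2 * u)) =
      Real.exp (-((s - y) ^ 2) / (4 * u)) := by
  rw [← Real.exp_add]
  congr 1
  rcases eq_or_ne u 0 with rfl | hu
  · simp
  · field_simp
    ring

/-- The one-dimensional heat kernel, up to a power of `u`, in terms of the entire function `E`. -/
def heatFactor (E : ℝ → ℝ) (y u s : ℝ) : ℝ :=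
  Real.exp (-(s ^ 2 + y ^ 2) / (4 * u)) * E (s * y / (2 * u))

def heatFactorDeriv (E : ℝ → ℝ) (y u s : ℝ) : ℝ :=
  Real.exp (-(s ^ 2 + y ^ 2) / (4 * u)) *
    (-(s / (2 * u)) * E (s * y / (2 * u)) + y / (2 * u) * deriv E (s * y / (2 * u)))

lemma hasDerivAt_heatFactor {E : ℝ → ℝ} (hE : Differentiable ℝ E) (y s : ℝ) {u : ℝ}
    (hu : 0 < u) : HasDerivAt (heatFactor E y u) (heatFactorDeriv E y u s) s := by
  have h1 : HasDerivAt (fun s : ℝ => -(s ^ 2 + y ^ 2) / (4 * u)) (-(s / (2 * u))) s := by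
    refine (((((hasDerivAt_id s).pow 2).add_const (y ^ 2)).neg).div_const (4 * u)).congr_deriv ?_
    simp only [id, Nat.cast_ofNat]
    field_simp
    ring
  have h2 : HasDerivAt (fun s : ℝ => s * y / (2 * u)) (y / (2 * u)) s := by
    simpa using ((hasDerivAt_id s).mul_const y).div_const (2 * u)
  refine (h1.exp.mul ((hE (s * y / (2 * u))).hasDerivAt.comp s h2)).congr_deriv ?_
  simp only [heatFactorDeriv, Function.comp]
  ring

lemma abs_heatFactor_le {E : ℝ → ℝ} {C : ℝ} (hE : ∀ z, 0 ≤ z → |E z| ≤ C * Real.exp z)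
    {y s u : ℝ} (hy : 0 < y) (hs : 0 < s) (hu : 0 < u) :
    |heatFactor E y u s| ≤ C * Real.exp (-((s - y) ^ 2) / (4 * u)) := by
  rw [heatFactor, abs_mul, Real.abs_exp, ← one_dim_exponent]
  calc _ ≤ Real.exp (-(s ^ 2 + y ^ 2) / (4 * u)) * (C * Real.exp (s * y / (2 * u))) :=
        mul_le_mul_of_nonneg_left (hE _ (by positivity)) (Real.exp_pos _).le
    _ = _ := by ring

lemma abs_heatFactorDeriv_le {E : ℝ → ℝ} {C : ℝ}
    (hE : ∀ z, 0 ≤ z → |E z| ≤ C * Real.exp z ∧ |deriv E z| ≤ C * Real.exp z)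
    {y s u : ℝ} (hy : 0 < y) (hs : 0 < s) (hu : 0 < u) :
    |heatFactorDeriv E y u s| ≤
      (s + y) / (2 * u) * (C * Real.exp (-((s - y) ^ 2) / (4 * u))) := by
  rw [heatFactorDeriv, abs_mul, Real.abs_exp, ← one_dim_exponent]
  obtain ⟨h1, h2⟩ := hE (s * y / (2 * u)) (by positivity)
  calc _ ≤ Real.exp (-(s ^ 2 + y ^ 2) / (4 * u)) *
        (s / (2 * u) * (C * Real.exp (s * y / (2 * u))) +
          y / (2 * u) * (C * Real.exp (s * y / (2 * u)))) := by
        refine mul_le_mul_of_nonneg_left ((abs_add_le _ _).trans ?_) (Real.exp_pos _).le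
        rw [abs_mul, abs_mul, abs_neg, abs_of_pos (by positivity : 0 < s / (2 * u)),
          abs_of_pos (by positivity : 0 < y / (2 * u))]
        gcongr
    _ = _ := by ring

lemma measurable_heatFactor {E : ℝ → ℝ} (hE : Differentiable ℝ E) (y s : ℝ) :
    Measurable fun u => heatFactor E y u s := by
  have := hE.continuous.measurable
  unfold heatFactor
  fun_prop

lemma measurable_heatFactorDeriv {E : ℝ → ℝ} (hE : Differentiable ℝ E) (y s : ℝ) :
    Measurable fun u => heatFactorDeriv E y u s := by
  have := hE.continuous.measurable
  have := measurable_deriv E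
  unfold heatFactorDeriv
  fun_prop

lemma heatK_eq_prod_heatFactor {d : ℕ} {α : Fin d → ℝ} {E : Fin d → ℝ → ℝ}
    (hE : ∀ j z, 0 < z → z ^ (-(α j) + 1 / 2) * besselI (α j - 1 / 2) z = E j z)
    {x y : Fin d → ℝ} (hx : x ∈ posOrth d) (hy : y ∈ posOrth d) {u : ℝ} (hu : 0 < u) :
    heatK d α u x y =
      (2 * u) ^ (-(∑ j, α j) - (d : ℝ) / 2) * ∏ j, heatFactor (E j) (y j) u (x j) := by
  have hexp : Real.exp (-((eNorm d x) ^ 2 + (eNorm d y) ^ 2) / (4 * u)) =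
      ∏ j, Real.exp (-((x j) ^ 2 + (y j) ^ 2) / (4 * u)) := by
    rw [← Real.exp_sum, eNorm, eNorm, Real.sq_sqrt (Finset.sum_nonneg fun j _ => sq_nonneg _),
      Real.sq_sqrt (Finset.sum_nonneg fun j _ => sq_nonneg _), ← Finset.sum_div,
      Finset.sum_neg_distrib, Finset.sum_add_distrib]
  simp only [heatK, heatFactor]
  rw [hexp, mul_assoc, ← Finset.prod_mul_distrib]
  congr 1
  refine Finset.prod_congr rfl fun j _ => ?_
  rw [hE j]
  have := hx j
  have := hy j
  positivity

lemma update_mem_posOrth {d : ℕ} {x : Fin d → ℝ} (hx : x ∈ posOrth d) (i : Fin d) {s : ℝ}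
    (hs : 0 < s) : Function.update x i s ∈ posOrth d := by
  intro j
  rcases eq_or_ne j i with rfl | h
  · simpa using hs
  · simpa [h] using hx j

lemma abs_prod_heatFactor_le {d : ℕ} {E : Fin d → ℝ → ℝ} {C : Fin d → ℝ}
    (hE : ∀ j z, 0 ≤ z → |E j z| ≤ C j * Real.exp z) (S : Finset (Fin d))
    {x y : Fin d → ℝ} (hx : x ∈ posOrth d) (hy : y ∈ posOrth d) {u : ℝ} (hu : 0 < u) :
    |∏ j ∈ S, heatFactor (E j) (y j) u (x j)| ≤
      ∏ j ∈ S, (C j * Real.exp (-((x j - y j) ^ 2) / (4 * u))) := by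
  rw [Finset.abs_prod]
  exact Finset.prod_le_prod (fun _ _ => abs_nonneg _)
    fun j _ => abs_heatFactor_le (hE j) (hy j) (hx j) hu

lemma prod_mul_gaussian {d : ℕ} (C x y : Fin d → ℝ) (u : ℝ) :
    ∏ j, (C j * Real.exp (-((x j - y j) ^ 2) / (4 * u))) =
      (∏ j, C j) * Real.exp (-(∑ j, (x j - y j) ^ 2) / (4 * u)) := by
  rw [Finset.prod_mul_distrib, ← Real.exp_sum, ← Finset.sum_div, Finset.sum_neg_distrib]

/-- The integrand defining the Poisson kernel in terms of the factors of the heat kernel. -/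
def poissonIntegrand (d : ℕ) (p : ℝ) (E : Fin d → ℝ → ℝ) (t : ℝ) (i : Fin d)
    (x y : Fin d → ℝ) (s u : ℝ) : ℝ :=
  u ^ (-(3 : ℝ) / 2) * Real.exp (-(t ^ 2) / (4 * u)) * (2 * u) ^ p *
    (heatFactor (E i) (y i) u s * ∏ j ∈ Finset.univ.erase i, heatFactor (E j) (y j) u (x j))

def poissonIntegrandDeriv (d : ℕ) (p : ℝ) (E : Fin d → ℝ → ℝ) (t : ℝ) (i : Fin d)
    (x y : Fin d → ℝ) (s u : ℝ) : ℝ :=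
  u ^ (-(3 : ℝ) / 2) * Real.exp (-(t ^ 2) / (4 * u)) * (2 * u) ^ p *
    (heatFactorDeriv (E i) (y i) u s *
      ∏ j ∈ Finset.univ.erase i, heatFactor (E j) (y j) u (x j))

lemma hasDerivAt_poissonIntegrand {d : ℕ} (p : ℝ) {E : Fin d → ℝ → ℝ}
    (hE : ∀ j, Differentiable ℝ (E j)) (t : ℝ) (i : Fin d) (x y : Fin d → ℝ) (s : ℝ) {u : ℝ}
    (hu : 0 < u) :
    HasDerivAt (fun s => poissonIntegrand d p E t i x y s u)
      (poissonIntegrandDeriv d p E t i x y s u) s :=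
  ((hasDerivAt_heatFactor (hE i) (y i) s hu).mul_const _).const_mul _

lemma measurable_poissonIntegrand {d : ℕ} (p : ℝ) {E : Fin d → ℝ → ℝ}
    (hE : ∀ j, Differentiable ℝ (E j)) (t : ℝ) (i : Fin d) (x y : Fin d → ℝ) (s : ℝ) :
    Measurable (poissonIntegrand d p E t i x y s) := by
  have h1 := measurable_heatFactor (hE i) (y i) s
  have h2 : Measurable fun u => ∏ j ∈ Finset.univ.erase i, heatFactor (E j) (y j) u (x j) :=
    Finset.measurable_fun_prod _ fun j _ => measurable_heatFactor (hE j) (y j) (x j)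
  unfold poissonIntegrand
  fun_prop

lemma measurable_poissonIntegrandDeriv {d : ℕ} (p : ℝ) {E : Fin d → ℝ → ℝ}
    (hE : ∀ j, Differentiable ℝ (E j)) (t : ℝ) (i : Fin d) (x y : Fin d → ℝ) (s : ℝ) :
    Measurable (poissonIntegrandDeriv d p E t i x y s) := by
  have h1 := measurable_heatFactorDeriv (hE i) (y i) s
  have h2 : Measurable fun u => ∏ j ∈ Finset.univ.erase i, heatFactor (E j) (y j) u (x j) :=
    Finset.measurable_fun_prod _ fun j _ => measurable_heatFactor (hE j) (y j) (x j)
  unfold poissonIntegrandDeriv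
  fun_prop

lemma poissonIntegrand_eq {d : ℕ} {α : Fin d → ℝ} {E : Fin d → ℝ → ℝ}
    (hE : ∀ j z, 0 < z → z ^ (-(α j) + 1 / 2) * besselI (α j - 1 / 2) z = E j z)
    (t : ℝ) (i : Fin d) {x y : Fin d → ℝ} (hx : x ∈ posOrth d) (hy : y ∈ posOrth d)
    {s u : ℝ} (hs : 0 < s) (hu : 0 < u) :
    u ^ (-(3 : ℝ) / 2) * Real.exp (-(t ^ 2) / (4 * u)) * heatK d α u (Function.update x i s) y =
      poissonIntegrand d (-(∑ j, α j) - (d : ℝ) / 2) E t i x y s u := by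
  rw [heatK_eq_prod_heatFactor hE (update_mem_posOrth hx i hs) hy hu, poissonIntegrand,
    ← Finset.mul_prod_erase _ _ (Finset.mem_univ i), Function.update_self]
  have : ∏ j ∈ Finset.univ.erase i, heatFactor (E j) (y j) u (Function.update x i s j) =
      ∏ j ∈ Finset.univ.erase i, heatFactor (E j) (y j) u (x j) :=
    Finset.prod_congr rfl fun j hj => by rw [Function.update_of_ne (Finset.ne_of_mem_erase hj)]
  rw [this]
  ring

lemma subordination_weight {p t S : ℝ} {u : ℝ} (hu : 0 < u) :
    u ^ (-(3 : ℝ) / 2) * Real.exp (-(t ^ 2) / (4 * u)) * (2 * u) ^ p *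
      Real.exp (-S / (4 * u)) =
        2 ^ p * (u ^ (-(1 / 2 - p) - 1) * Real.exp (-((t ^ 2 + S) / 4) / u)) := by
  have h1 : Real.exp (-((t ^ 2 + S) / 4) / u) =
      Real.exp (-(t ^ 2) / (4 * u)) * Real.exp (-S / (4 * u)) := by
    rw [← Real.exp_add]
    congr 1
    field_simp
    ring
  have h2 : u ^ (-(1 / 2 - p) - 1) = u ^ (-(3 : ℝ) / 2) * u ^ p := by
    rw [← Real.rpow_add hu]
    congr 1
    ring
  rw [h1, h2, Real.mul_rpow (by norm_num) hu.le]
  ring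

lemma abs_poissonIntegrand_le {d : ℕ} (p : ℝ) {E : Fin d → ℝ → ℝ} {C : Fin d → ℝ}
    (hE : ∀ j z, 0 ≤ z → |E j z| ≤ C j * Real.exp z ∧ |deriv (E j) z| ≤ C j * Real.exp z)
    (t : ℝ) (i : Fin d) {x y : Fin d → ℝ} (hx : x ∈ posOrth d) (hy : y ∈ posOrth d)
    {u : ℝ} (hu : 0 < u) :
    |poissonIntegrand d p E t i x y (x i) u| ≤
      (∏ j, C j) * 2 ^ p * (u ^ (-(1 / 2 - p) - 1) *
        Real.exp (-((t ^ 2 + ∑ j, (x j - y j) ^ 2) / 4) / u)) := by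
  rw [poissonIntegrand, Finset.mul_prod_erase Finset.univ
    (fun j => heatFactor (E j) (y j) u (x j)) (Finset.mem_univ i), abs_mul,
    abs_of_nonneg (by positivity)]
  refine (mul_le_mul_of_nonneg_left (abs_prod_heatFactor_le (fun j z hz => (hE j z hz).1)
    Finset.univ hx hy hu) (by positivity)).trans_eq ?_
  rw [prod_mul_gaussian, mul_assoc (∏ j, C j), ← subordination_weight hu]
  ring

lemma abs_poissonIntegrandDeriv_le {d : ℕ} (p : ℝ) {E : Fin d → ℝ → ℝ} {C : Fin d → ℝ}
    (hE : ∀ j z, 0 ≤ z → |E j z| ≤ C j * Real.exp z ∧ |deriv (E j) z| ≤ C j * Real.exp z)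
    (t : ℝ) (i : Fin d) {x y : Fin d → ℝ} (hx : x ∈ posOrth d) (hy : y ∈ posOrth d)
    {u : ℝ} (hu : 0 < u) :
    |poissonIntegrandDeriv d p E t i x y (x i) u| ≤
      (∏ j, C j) * 2 ^ (p - 1) * (x i + y i) * (u ^ (-(3 / 2 - p) - 1) *
        Real.exp (-((t ^ 2 + ∑ j, (x j - y j) ^ 2) / 4) / u)) := by
  have hxi := hx i
  have hyi := hy i
  have h1 := abs_heatFactorDeriv_le (hE i) hyi hxi hu
  have h2 := abs_prod_heatFactor_le (fun j z hz => (hE j z hz).1) (Finset.univ.erase i) hx hy hu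
  have h3 : |heatFactorDeriv (E i) (y i) u (x i) *
      ∏ j ∈ Finset.univ.erase i, heatFactor (E j) (y j) u (x j)| ≤
      (x i + y i) / (2 * u) *
        ((∏ j, C j) * Real.exp (-(∑ j, (x j - y j) ^ 2) / (4 * u))) := by
    rw [abs_mul, ← prod_mul_gaussian, ← Finset.mul_prod_erase _ _ (Finset.mem_univ i),
      ← mul_assoc]
    exact mul_le_mul h1 h2 (abs_nonneg _) ((abs_nonneg _).trans h1)
  rw [poissonIntegrandDeriv, abs_mul, abs_of_nonneg (by positivity)]
  refine (mul_le_mul_of_nonneg_left h3 (by positivity)).trans_eq ?_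
  have h4 : u ^ (-(3 / 2 - p) - 1) = u ^ (-(1 / 2 - p) - 1) / u := by
    rw [← Real.rpow_sub_one hu.ne']
    congr 1
    ring
  rw [h4, Real.rpow_sub_one two_ne_zero]
  have h5 := subordination_weight (p := p) (t := t) (S := ∑ j, (x j - y j) ^ 2) hu
  calc _ = (x i + y i) / (2 * u) * (∏ j, C j) * (u ^ (-(3 : ℝ) / 2) *
        Real.exp (-(t ^ 2) / (4 * u)) * (2 * u) ^ p *
          Real.exp (-(∑ j, (x j - y j) ^ 2) / (4 * u))) := by ring
    _ = _ := by
      rw [h5]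
      field_simp

lemma hasDerivAt_integral_poissonIntegrand {d : ℕ} {p : ℝ} (hp : p < 1 / 2)
    {E : Fin d → ℝ → ℝ} {C : Fin d → ℝ} (hC : ∀ j, 0 < C j)
    (hdiff : ∀ j, Differentiable ℝ (E j))
    (hE : ∀ j z, 0 ≤ z → |E j z| ≤ C j * Real.exp z ∧ |deriv (E j) z| ≤ C j * Real.exp z)
    {t : ℝ} (ht : 0 < t) (i : Fin d) {x y : Fin d → ℝ} (hx : x ∈ posOrth d)
    (hy : y ∈ posOrth d) :
    HasDerivAt (fun s => ∫ u in Set.Ioi (0 : ℝ), poissonIntegrand d p E t i x y s u)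
      (∫ u in Set.Ioi (0 : ℝ), poissonIntegrandDeriv d p E t i x y (x i) u) (x i) := by
  have hxi := hx i
  have hyi := hy i
  have hCC : 0 < ∏ j, C j := Finset.prod_pos fun j _ => hC j
  refine (hasDerivAt_integral_of_dominated_loc_of_deriv_le
    (s := Set.Ioo 0 (2 * x i)) (bound := fun u => (∏ j, C j) * 2 ^ (p - 1) * (2 * x i + y i) *
      (u ^ (-(3 / 2 - p) - 1) * Real.exp (-(t ^ 2 / 4) / u)))
    (Ioo_mem_nhds hxi (by linarith))
    (Eventually.of_forall fun s =>
      (measurable_poissonIntegrand p hdiff t i x y s).aestronglyMeasurable) ?_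
    (measurable_poissonIntegrandDeriv p hdiff t i x y (x i)).aestronglyMeasurable ?_
    ((integrableOn_rpow_mul_exp_neg_div_Ioi (by linarith) (by positivity)).const_mul _) ?_).2
  · have hS : 0 < (t ^ 2 + ∑ j, (x j - y j) ^ 2) / 4 := by positivity
    refine ((integrableOn_rpow_mul_exp_neg_div_Ioi (a := 1 / 2 - p) (by linarith)
      hS).const_mul ((∏ j, C j) * 2 ^ p)).mono'
      (measurable_poissonIntegrand p hdiff t i x y (x i)).aestronglyMeasurable ?_
    filter_upwards [ae_restrict_mem measurableSet_Ioi] with u hu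
    exact abs_poissonIntegrand_le p hE t i hx hy hu
  · filter_upwards [ae_restrict_mem measurableSet_Ioi] with u hu s hs
    have hu : 0 < u := hu
    have h := abs_poissonIntegrandDeriv_le p hE t i (update_mem_posOrth hx i hs.1) hy hu
    have h' : poissonIntegrandDeriv d p E t i (Function.update x i s) y s u =
        poissonIntegrandDeriv d p E t i x y s u := by
      unfold poissonIntegrandDeriv
      congr 2
      exact Finset.prod_congr rfl fun j hj => by
        rw [Function.update_of_ne (Finset.ne_of_mem_erase hj)]
    rw [Function.update_self, h'] at h
    refine h.trans ?_
    have hs0 := hs.1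
    have hS : 0 ≤ ∑ j, (Function.update x i s j - y j) ^ 2 :=
      Finset.sum_nonneg fun j _ => sq_nonneg _
    gcongr
    · exact hs.2.le
    · linarith
  · filter_upwards [ae_restrict_mem measurableSet_Ioi] with u hu s _
    exact hasDerivAt_poissonIntegrand p hdiff t i x y s hu

lemma abs_integral_poissonIntegrandDeriv_le {d : ℕ} {p : ℝ} (hp : p < 1 / 2)
    {E : Fin d → ℝ → ℝ} {C : Fin d → ℝ}
    (hE : ∀ j z, 0 ≤ z → |E j z| ≤ C j * Real.exp z ∧ |deriv (E j) z| ≤ C j * Real.exp z)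
    {t : ℝ} (ht : 0 < t) (i : Fin d) {x y : Fin d → ℝ} (hx : x ∈ posOrth d)
    (hy : y ∈ posOrth d) :
    |∫ u in Set.Ioi (0 : ℝ), poissonIntegrandDeriv d p E t i x y (x i) u| ≤
      (∏ j, C j) * 2 ^ (p - 1) * (x i + y i) *
        (((t ^ 2 + ∑ j, (x j - y j) ^ 2) / 4) ^ (-(3 / 2 - p)) * Real.Gamma (3 / 2 - p)) := by
  have ha : 0 < 3 / 2 - p := by linarith
  have hS : 0 < (t ^ 2 + ∑ j, (x j - y j) ^ 2) / 4 := by positivity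
  rw [← integral_rpow_mul_exp_neg_div_Ioi ha hS, ← integral_const_mul, ← Real.norm_eq_abs]
  refine norm_integral_le_of_norm_le
    ((integrableOn_rpow_mul_exp_neg_div_Ioi ha hS).const_mul _) ?_
  filter_upwards [ae_restrict_mem measurableSet_Ioi] with u hu
  exact abs_poissonIntegrandDeriv_le p hE t i hx hy hu

/-- Gradient estimate for the Bessel–Poisson kernel. -/
theorem poisson_kernel_deriv_estimate (d : ℕ) (α : Fin d → ℝ)
    (hα : ∀ j, 0 ≤ α j) :
    ∃ C > (0 : ℝ), ∀ i : Fin d, ∀ x ∈ posOrth d, ∀ y ∈ posOrth d, ∀ t > (0 : ℝ),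
      |pd d i (fun z => poissonK d α t z y) x| ≤
        C * t * (x i + y i) / (t ^ 2 + ∑ j, (x j - y j) ^ 2) ^
          ((∑ j, α j) + ((d : ℝ) + 3) / 2) := by
  choose C E hC hdiff hB hE using fun j => exists_entire_besselI (hα j)
  have hA : 0 ≤ ∑ j, α j := Finset.sum_nonneg fun j _ => hα j
  obtain ⟨p, hp⟩ : ∃ p, p = -(∑ j, α j) - (d : ℝ) / 2 := ⟨_, rfl⟩
  have hp0 : p < 1 / 2 := by
    have : (0 : ℝ) ≤ d := Nat.cast_nonneg d
    linarith
  have ha : (∑ j, α j) + ((d : ℝ) + 3) / 2 = 3 / 2 - p := by rw [hp]; ring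
  have hG : 0 < Real.Gamma (3 / 2 - p) := Real.Gamma_pos_of_pos (by linarith)
  have hCC : 0 < ∏ j, C j := Finset.prod_pos fun j _ => hC j
  refine ⟨1 / Real.sqrt (2 * Real.pi) * (∏ j, C j) * 2 ^ (p - 1) * 4 ^ (3 / 2 - p) *
    Real.Gamma (3 / 2 - p), by positivity, fun i x hx y hy t ht => ?_⟩
  rw [ha]
  have hS : 0 < t ^ 2 + ∑ j, (x j - y j) ^ 2 := by positivity
  have hpd : HasDerivAt (fun s => poissonK d α t (Function.update x i s) y)
      (t / Real.sqrt (2 * Real.pi) *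
        ∫ u in Set.Ioi (0 : ℝ), poissonIntegrandDeriv d p E t i x y (x i) u) (x i) := by
    refine ((hasDerivAt_integral_poissonIntegrand hp0 hC hdiff hE ht i hx hy).const_mul
      _).congr_of_eventuallyEq ?_
    filter_upwards [Ioi_mem_nhds (hx i)] with s hs
    rw [poissonK]
    congr 1
    refine setIntegral_congr_fun measurableSet_Ioi fun u hu => ?_
    rw [hp]
    exact poissonIntegrand_eq hB t i hx hy hs hu
  rw [pd, hpd.deriv, abs_mul, abs_of_nonneg (by positivity)]
  refine (mul_le_mul_of_nonneg_left
    (abs_integral_poissonIntegrandDeriv_le hp0 hE ht i hx hy) (by positivity)).trans_eq ?_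
  rw [Real.div_rpow hS.le (by norm_num), Real.rpow_neg hS.le,
    Real.rpow_neg (by norm_num : (0 : ℝ) ≤ 4)]
  field_simp
end
end

section
/- Let α ∈ [0,∞)^d. There exists a constant C_α > 0, depending only on α and d, such that for every x, y ∈ ℝ_+^d and every t > 0, the Bessel heat kernel satisfies 0 < 𝒲_t^α(x,y) ≤ C_α e^{−|x−y|²/(4t)} / (2t)^{|α| + d/2}. -/
open MeasureTheory Real Filter Set
open scoped ENNReal BigOperators

noncomputable section

/-- For `a ≥ 1/2`, the duplication-type comparison `Γ(a) (2k)! ≤ 4^k k! Γ(k + a)`. -/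
theorem Gamma_mul_factorial_two_mul_le {a : ℝ} (ha : 1 / 2 ≤ a) (k : ℕ) :
    Real.Gamma a * ((2 * k).factorial : ℝ) ≤
      4 ^ k * ((k.factorial : ℝ) * Real.Gamma ((k : ℝ) + a)) := by
  induction k with
  | zero => simp
  | succ k ih =>
    have hk : (0 : ℝ) ≤ k := k.cast_nonneg
    have hG : Real.Gamma (((k + 1 : ℕ) : ℝ) + a) = (k + a) * Real.Gamma (k + a) := by
      rw [← Real.Gamma_add_one (by linarith)]
      congr 1
      push_cast
      ring
    have hG0 : 0 < Real.Gamma ((k : ℝ) + a) := Real.Gamma_pos_of_pos (by linarith)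
    have hf : ((2 * (k + 1)).factorial : ℝ) =
        (2 * k + 2) * (2 * k + 1) * ((2 * k).factorial : ℝ) := by
      rw [show 2 * (k + 1) = 2 * k + 1 + 1 by ring, Nat.factorial_succ, Nat.factorial_succ]
      push_cast
      ring
    rw [hf, hG, Nat.factorial_succ]
    push_cast
    calc Real.Gamma a * ((2 * k + 2) * (2 * k + 1) * ((2 * k).factorial : ℝ))
        = (2 * k + 2) * (2 * k + 1) * (Real.Gamma a * ((2 * k).factorial : ℝ)) := by ring
      _ ≤ (2 * k + 2) * (2 * k + 2 * a) *
          (4 ^ k * ((k.factorial : ℝ) * Real.Gamma ((k : ℝ) + a))) := by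
        gcongr
        linarith
      _ = _ := by ring

/-- For `α ≥ 0` and `z > 0`,
`0 < z^{-α+1/2} I_{α-1/2}(z) ≤ 2^{1/2-α} Γ(α+1/2)⁻¹ e^z`. -/
theorem rpow_mul_besselI_pos_and_le {α z : ℝ} (hα : 0 ≤ α) (hz : 0 < z) :
    0 < z ^ (-α + 1 / 2) * besselI (α - 1 / 2) z ∧
      z ^ (-α + 1 / 2) * besselI (α - 1 / 2) z ≤
        2 ^ (1 / 2 - α) / Real.Gamma (α + 1 / 2) * Real.exp z := by
  set c : ℝ := 2 ^ (1 / 2 - α) / Real.Gamma (α + 1 / 2)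
  have hΓ : 0 < Real.Gamma (α + 1 / 2) := Real.Gamma_pos_of_pos (by linarith)
  have hc : 0 < c := by positivity
  have hcosh := (Real.hasSum_cosh z).mul_left c
  set g : ℕ → ℝ := fun k => z ^ (-α + 1 / 2) *
    ((1 / ((k.factorial : ℝ) * Real.Gamma ((k : ℝ) + (α - 1 / 2) + 1))) *
      (z / 2) ^ (2 * (k : ℝ) + (α - 1 / 2)))
  have hΓk (k : ℕ) : 0 < Real.Gamma ((k : ℝ) + (α - 1 / 2) + 1) :=
    Real.Gamma_pos_of_pos (by linarith [k.cast_nonneg (α := ℝ)])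
  have hpos (k : ℕ) : 0 < g k := by
    have := hΓk k
    positivity
  have hle (k : ℕ) : g k ≤ c * (z ^ (2 * k) / ((2 * k).factorial : ℝ)) := by
    have hcmp := Gamma_mul_factorial_two_mul_le (a := α + 1 / 2) (by linarith) k
    have hk := hΓk k
    rw [show (k : ℝ) + (α - 1 / 2) + 1 = k + (α + 1 / 2) by ring] at hk
    have hpow : z ^ (-α + 1 / 2) * (z / 2) ^ (2 * (k : ℝ) + (α - 1 / 2)) =
        2 ^ (1 / 2 - α) * (z ^ (2 * k) / 4 ^ k) := by
      rw [Real.rpow_add (show 0 < z / 2 by positivity), Real.div_rpow hz.le zero_le_two (α - 1 / 2),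
        show 2 * (k : ℝ) = ((2 * k : ℕ) : ℝ) by push_cast; ring, Real.rpow_natCast, div_pow,
        show (-α + 1 / 2) = -(α - 1 / 2) by ring, show (1 / 2 - α) = -(α - 1 / 2) by ring,
        Real.rpow_neg hz.le, Real.rpow_neg zero_le_two, pow_mul 2 2 k]
      have h1 : z ^ (α - 1 / 2) ≠ 0 := by positivity
      have h2 : (2 : ℝ) ^ (α - 1 / 2) ≠ 0 := by positivity
      norm_num
      field_simp
    calc
      g k = 2 ^ (1 / 2 - α) * z ^ (2 * k) *
          (1 / (4 ^ k * ((k.factorial : ℝ) * Real.Gamma ((k : ℝ) + (α + 1 / 2))))) := by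
        simp only [g]
        rw [mul_left_comm, hpow, show (k : ℝ) + (α - 1 / 2) + 1 = k + (α + 1 / 2) by ring]
        field_simp
      _ ≤ 2 ^ (1 / 2 - α) * z ^ (2 * k) *
          (1 / (Real.Gamma (α + 1 / 2) * ((2 * k).factorial : ℝ))) := by
        gcongr
      _ = _ := by
        simp only [c]
        field_simp
  have hsum : Summable g := Summable.of_nonneg_of_le (fun k => (hpos k).le) hle hcosh.summable
  have heq : z ^ (-α + 1 / 2) * besselI (α - 1 / 2) z = ∑' k, g k := by
    rw [besselI, ← tsum_mul_left]
  rw [heq]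
  refine ⟨hsum.tsum_pos (fun k => (hpos k).le) 0 (hpos 0), ?_⟩
  calc ∑' k, g k ≤ c * Real.cosh z := hasSum_le hle hsum.hasSum hcosh
    _ ≤ c * Real.exp z := by
      gcongr
      rw [Real.cosh_eq]
      linarith [Real.exp_le_exp.2 (show -z ≤ z by linarith)]

theorem eNorm_sq (d : ℕ) (x : Fin d → ℝ) : eNorm d x ^ 2 = ∑ j, x j ^ 2 :=
  Real.sq_sqrt (Finset.sum_nonneg fun j _ => sq_nonneg (x j))

/-- Gaussian upper bound for the Bessel heat kernel. -/
theorem heat_kernel_estimate (d : ℕ) (α : Fin d → ℝ) (hα : ∀ j, 0 ≤ α j) :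
    ∃ C > (0 : ℝ), ∀ x ∈ posOrth d, ∀ y ∈ posOrth d, ∀ t > (0 : ℝ),
      0 < heatK d α t x y ∧
      heatK d α t x y ≤
        C * Real.exp (-(∑ j, (x j - y j) ^ 2) / (4 * t)) /
          (2 * t) ^ ((∑ j, α j) + (d : ℝ) / 2) := by
  have hΓ (j : Fin d) : 0 < Real.Gamma (α j + 1 / 2) :=
    Real.Gamma_pos_of_pos (by linarith [hα j])
  refine ⟨∏ j, 2 ^ (1 / 2 - α j) / Real.Gamma (α j + 1 / 2),
    Finset.prod_pos fun j _ => div_pos (by positivity) (hΓ j), fun x hx y hy t ht => ?_⟩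
  have key (j : Fin d) := rpow_mul_besselI_pos_and_le (hα j)
    (show 0 < x j * y j / (2 * t) from div_pos (mul_pos (hx j) (hy j)) (by positivity))
  refine ⟨mul_pos (by positivity) (Finset.prod_pos fun j _ => (key j).1), ?_⟩
  have hexp : Real.exp (-(eNorm d x ^ 2 + eNorm d y ^ 2) / (4 * t)) *
      Real.exp (∑ j, x j * y j / (2 * t)) =
      Real.exp (-(∑ j, (x j - y j) ^ 2) / (4 * t)) := by
    rw [← Real.exp_add, eNorm_sq, eNorm_sq, ← Finset.sum_div, ← Finset.sum_add_distrib]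
    congr 1
    have : ∑ j, (x j - y j) ^ 2 = ∑ j, (x j ^ 2 + y j ^ 2) - 2 * ∑ j, x j * y j := by
      rw [Finset.mul_sum, ← Finset.sum_sub_distrib]
      exact Finset.sum_congr rfl fun j _ => by ring
    rw [this]
    field_simp
    ring
  calc heatK d α t x y
      ≤ (2 * t) ^ (-(∑ j, α j) - (d : ℝ) / 2) *
          Real.exp (-((eNorm d x) ^ 2 + (eNorm d y) ^ 2) / (4 * t)) *
          ∏ j, (2 ^ (1 / 2 - α j) / Real.Gamma (α j + 1 / 2) *
            Real.exp (x j * y j / (2 * t))) :=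
        mul_le_mul_of_nonneg_left
          (Finset.prod_le_prod (fun j _ => (key j).1.le) fun j _ => (key j).2) (by positivity)
    _ = _ := by
      rw [Finset.prod_mul_distrib, ← Real.exp_sum, ← hexp,
        show -(∑ j, α j) - (d : ℝ) / 2 = -((∑ j, α j) + (d : ℝ) / 2) by ring,
        Real.rpow_neg (by positivity), div_eq_mul_inv]
      ring
end
end
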